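/- The Apéry-like series of weight 5 evaluates as: ∑_{k=1}^∞ 4^k H_k^2 / (k^3 · C(2k,k)) = −62 ζ(5) − (21/2)ζ(2)ζ(3) + 48 Li_5(1/2) + 81 ln(2) ζ(4) + 8 ln^3(2) ζ(2) − (2/5) ln^5(2). -/

import Mathlib

open Real

/-- Riemann zeta value at a positive integer `m > 1`, as the series `∑ 1/n^m`. -/
noncomputable def zetaVal (m : ℕ) : ℝ := ∑' n : ℕ, 1 / (n + 1 : ℝ) ^ m

/-- Polylogarithm `Li_m(z) = ∑_{k≥1} z^k / k^m`. -/
noncomputable def polyLog (m : ℕ) (z : ℝ) : ℝ := ∑' k : ℕ, z ^ (k + 1) / (k + 1 : ℝ) ^ m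

/-- Generalized harmonic number `H_k^{(m)} = ∑_{n=1}^k 1/n^m`. -/
noncomputable def genHarmonic (k m : ℕ) : ℝ := ∑ n ∈ Finset.range k, 1 / (n + 1 : ℝ) ^ m

open Set Filter Topology MeasureTheory

/-- The open quarter period. -/
abbrev QI : Set ℝ := Set.Ioo 0 (π / 2)

/-- `log (sin θ)`. -/
noncomputable def ls (t : ℝ) : ℝ := Real.log (Real.sin t)

lemma ftcE {E : Type*} [NormedAddCommGroup E] [NormedSpace ℝ E] [CompleteSpace E]
    {F f : ℝ → E} {a b : ℝ} {A B : E} (hab : a < b)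
    (hd : ∀ x ∈ Ioo a b, HasDerivAt F (f x) x) (hi : IntegrableOn f (Ioo a b))
    (ha : Tendsto F (𝓝[>] a) (𝓝 A)) (hb : Tendsto F (𝓝[<] b) (𝓝 B)) :
    ∫ x in Ioo a b, f x = B - A := by
  rw [← integral_Ioc_eq_integral_Ioo, ← intervalIntegral.integral_of_le hab.le]
  refine intervalIntegral.integral_eq_sub_of_hasDerivAt_of_tendsto hab hd ?_ ha hb
  rw [intervalIntegrable_iff_integrableOn_Ioo_of_le hab.le]
  exact hi

lemma QI_sin_pos {t : ℝ} (ht : t ∈ QI) : 0 < sin t :=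
  sin_pos_of_pos_of_lt_pi ht.1 (by linarith [ht.2, pi_pos])

lemma QI_cos_pos {t : ℝ} (ht : t ∈ QI) : 0 < cos t :=
  cos_pos_of_mem_Ioo ⟨by linarith [ht.1, pi_pos], ht.2⟩

lemma ls_nonpos {t : ℝ} (ht : t ∈ QI) : ls t ≤ 0 :=
  Real.log_nonpos (QI_sin_pos ht).le (sin_le_one t)

lemma ls_hasDeriv {t : ℝ} (ht : t ∈ QI) : HasDerivAt ls (cos t / sin t) t :=
  (hasDerivAt_sin t).log (QI_sin_pos ht).ne'

lemma ls_cont : ContinuousOn ls QI := fun _ ht => (ls_hasDeriv ht).continuousAt.continuousWithinAt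

lemma tan_cont : ContinuousOn tan QI := fun _ ht =>
  (continuousAt_tan.2 (QI_cos_pos ht).ne').continuousWithinAt

lemma ls_tan_bound {t : ℝ} (ht : t ∈ QI) : |ls t * tan t| ≤ 1 := by
  have hs := QI_sin_pos ht
  have hc := QI_cos_pos ht
  have h1 := Real.one_sub_inv_le_log_of_pos (x := sin t ^ 2) (by positivity)
  rw [Real.log_pow] at h1
  have h2 : (1:ℝ) - (sin t ^ 2)⁻¹ = - (cos t ^ 2 / sin t ^ 2) := by
    have := sin_sq_add_cos_sq t
    field_simp; linarith
  rw [h2] at h1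
  have h3 : -ls t ≤ cos t ^ 2 / sin t ^ 2 / 2 := by
    unfold ls; push_cast at h1; linarith

  have h4 := Real.one_sub_inv_le_log_of_pos hs
  have h5 : -ls t ≤ (1 - sin t) / sin t := by
    unfold ls
    have : (1 - sin t) / sin t = (sin t)⁻¹ - 1 := by field_simp
    linarith
  have hn := ls_nonpos ht
  rw [abs_of_nonpos (mul_nonpos_of_nonpos_of_nonneg hn (by rw [tan_eq_sin_div_cos]; positivity))]
  rw [tan_eq_sin_div_cos, ← neg_mul, ← mul_div_assoc, div_le_one hc]
  have h6 : -ls t * sin t ≤ 1 - sin t := by rwa [le_div_iff₀ hs] at h5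
  refine h6.trans ?_
  have := sin_sq_add_cos_sq t
  nlinarith [sin_le_one t, cos_le_one t]

lemma log_pow_bound {x : ℝ} (h0 : 0 < x) (h1 : x ≤ 1) : |log x| ^ 4 ≤ 4096 * x ^ (-(1/2) : ℝ) := by
  have h := Real.abs_log_mul_self_rpow_lt x (1/8) h0 h1 (by norm_num)
  rw [abs_mul, abs_of_pos (rpow_pos_of_pos h0 (1/8 : ℝ))] at h
  have h2 : (|log x| * x ^ (1/8 : ℝ)) ^ 4 ≤ 8 ^ 4 := by
    gcongr; norm_num at h ⊢; exact h.le
  rw [mul_pow, ← Real.rpow_natCast, ← Real.rpow_natCast (x ^ _), ← Real.rpow_mul h0.le] at h2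
  norm_num at h2
  have hx : x ^ (1/2 : ℝ) * x ^ (-(1/2) : ℝ) = 1 := by
    rw [← Real.rpow_add h0]; norm_num
  have hp := rpow_pos_of_pos h0 (-(1/2) : ℝ)
  calc |log x| ^ 4 = (|log x| ^ 4 * x ^ (1/2:ℝ)) * x ^ (-(1/2) : ℝ) := by
        rw [mul_assoc, hx, mul_one]
    _ ≤ _ := by
      have h3 : |log x| ^ 4 * x ^ (1/2:ℝ) ≤ 4096 := by
        norm_num at h2 ⊢; exact h2
      gcongr

lemma log_bound_integrable : IntegrableOn (fun x : ℝ => 1 + |log x| ^ 4) (Ioo 0 1) := by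
  refine Integrable.add (integrableOn_const (by simp)) ?_
  have hi : IntegrableOn (fun x : ℝ => 4096 * x ^ (-(1/2) : ℝ)) (Ioo 0 1) := by
    refine Integrable.const_mul ?_ _
    have := (intervalIntegral.intervalIntegrable_rpow' (a := 0) (b := 1) (r := -(1/2)) (by norm_num))
    rwa [intervalIntegrable_iff_integrableOn_Ioo_of_le zero_le_one] at this
  refine Integrable.mono' hi (Measurable.aestronglyMeasurable (by fun_prop)) ?_
  filter_upwards [self_mem_ae_restrict measurableSet_Ioo] with x hx
  rw [norm_of_nonneg (by positivity)]
  exact log_pow_bound hx.1 hx.2.le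

lemma ls_bound_integrable : IntegrableOn (fun t : ℝ => 1 + |ls t| ^ 4) QI := by
  refine Integrable.add (integrableOn_const (by simp)) ?_
  have hi : IntegrableOn (fun x : ℝ => 4096 * (2 / π * x) ^ (-(1/2) : ℝ)) QI := by
    refine Integrable.const_mul ?_ _
    have := (intervalIntegral.intervalIntegrable_rpow' (a := 0) (b := π / 2) (r := -(1/2))
      (by norm_num))
    rw [intervalIntegrable_iff_integrableOn_Ioo_of_le (by positivity)] at this
    refine (this.const_mul ((2/π) ^ (-(1/2) : ℝ))).congr ?_
    filter_upwards [self_mem_ae_restrict measurableSet_Ioo] with x hx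
    rw [Real.mul_rpow (by positivity) hx.1.le]
  refine Integrable.mono' hi ((ls_cont.abs.pow 4).aestronglyMeasurable measurableSet_Ioo) ?_
  filter_upwards [self_mem_ae_restrict measurableSet_Ioo] with x hx
  rw [norm_of_nonneg (by positivity)]
  have hp : 0 < 2 / π * x := mul_pos (by positivity) hx.1
  have hle := Real.mul_le_sin hx.1.le hx.2.le
  have h1 := log_pow_bound hp (hle.trans (sin_le_one x))
  refine le_trans ?_ h1
  gcongr 1
  rw [abs_of_nonpos (ls_nonpos hx), abs_of_nonpos (Real.log_nonpos hp.le (hle.trans (sin_le_one x)))]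
  have := Real.log_le_log hp hle
  unfold ls; linarith

lemma intQ {E : Type*} [NormedAddCommGroup E] {f : ℝ → E} (C : ℝ)
    (hc : ContinuousOn f QI) (hb : ∀ t ∈ QI, ‖f t‖ ≤ C * (1 + |ls t| ^ 4)) : IntegrableOn f QI := by
  refine Integrable.mono' (ls_bound_integrable.const_mul C)
    (hc.aestronglyMeasurable measurableSet_Ioo) ?_
  filter_upwards [self_mem_ae_restrict measurableSet_Ioo] with x hx
  exact hb x hx

lemma pow_le_one_add {a : ℝ} (ha : 0 ≤ a) {k : ℕ} (hk : k ≤ 4) : a ^ k ≤ 1 + a ^ 4 := by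
  rcases le_total a 1 with h | h
  · have := pow_le_one₀ ha h (n := k)
    have : 0 ≤ a ^ 4 := by positivity
    linarith
  · have := pow_le_pow_right₀ h hk
    linarith

/-- integrability of (bounded continuous) * ls^k -/
lemma intQ_mul {f : ℝ → ℝ} (C : ℝ) (k : ℕ) (hk : k ≤ 4) (hc : ContinuousOn f QI)
    (hb : ∀ t ∈ QI, |f t| ≤ C) : IntegrableOn (fun t => f t * ls t ^ k) QI := by
  refine intQ C (hc.mul (ls_cont.pow k)) fun t ht => ?_
  rw [norm_mul, norm_pow, Real.norm_eq_abs, Real.norm_eq_abs]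
  have := hb t ht
  have := pow_le_one_add (abs_nonneg (ls t)) hk
  have h0 : 0 ≤ C := (abs_nonneg _).trans (hb t ht)
  gcongr

lemma pow_log_tendsto (n m : ℕ) (hn : 0 < n) :
    Tendsto (fun x : ℝ => x ^ n * log x ^ m) (𝓝[>] 0) (𝓝 0) := by
  rcases Nat.eq_zero_or_pos m with rfl | hm
  · simp only [pow_zero, mul_one]
    have : Tendsto (fun x : ℝ => x ^ n) (𝓝 0) (𝓝 (0 ^ n)) := (continuous_pow n).tendsto 0
    rw [zero_pow hn.ne'] at this
    exact this.mono_left nhdsWithin_le_nhds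
  have h := (tendsto_log_mul_rpow_nhdsGT_zero (r := (n:ℝ) / m) (by positivity)).pow m
  rw [zero_pow hm.ne'] at h
  refine h.congr' ?_
  filter_upwards [self_mem_nhdsWithin] with x hx
  have hx : 0 < x := hx
  rw [mul_pow, ← Real.rpow_natCast (x ^ _), ← Real.rpow_mul hx.le, div_mul_cancel₀ _ (by positivity),
    Real.rpow_natCast, mul_comm]

lemma sin_tendsto_zero : Tendsto sin (𝓝[>] 0) (𝓝[>] 0) := by
  rw [tendsto_nhdsWithin_iff]
  constructor
  · have := (continuous_sin.tendsto 0).mono_left (nhdsWithin_le_nhds (s := Ioi 0))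
    rwa [sin_zero] at this
  · filter_upwards [Ioo_mem_nhdsGT (show (0:ℝ) < π by positivity)] with x hx
    exact sin_pos_of_pos_of_lt_pi hx.1 hx.2

lemma sin_pow_ls_tendsto (n m : ℕ) (hn : 0 < n) :
    Tendsto (fun t : ℝ => sin t ^ n * ls t ^ m) (𝓝[>] 0) (𝓝 0) :=
  (pow_log_tendsto n m hn).comp sin_tendsto_zero

lemma ls_tendsto_half : Tendsto ls (𝓝[<] (π/2)) (𝓝 0) := by
  have : ContinuousAt ls (π/2) := by
    unfold ls
    refine ContinuousAt.log continuous_sin.continuousAt (by simp)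
  have h := this.tendsto
  rw [show ls (π/2) = 0 by simp [ls]] at h
  exact h.mono_left nhdsWithin_le_nhds

lemma sin_moment (n m : ℕ) (hm : m ≤ 4) :
    ∫ t in QI, sin t ^ n * cos t * ls t ^ m = (-1) ^ m * m.factorial / (n + 1 : ℝ) ^ (m + 1) := by
  have hIntg : ∀ m ≤ 4, IntegrableOn (fun t => sin t ^ n * cos t * ls t ^ m) QI := fun m hm =>
    intQ_mul 1 m hm (by fun_prop) (fun t _ => by
      rw [abs_mul, abs_pow]
      exact mul_le_one₀ (pow_le_one₀ (abs_nonneg _) (abs_sin_le_one t)) (abs_nonneg _)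
        (abs_cos_le_one t))
  have hn : (n + 1 : ℝ) ≠ 0 := by positivity
  induction m with
  | zero =>
    have h := ftcE (F := fun t => sin t ^ (n + 1) / (n + 1)) (a := 0) (b := π / 2)
      (f := fun t => sin t ^ n * cos t * ls t ^ 0) (A := 0) (B := 1 / (n + 1)) (by positivity)
      (fun x hx => by
        have := ((hasDerivAt_sin x).pow (n + 1)).div_const (n + 1 : ℝ)
        convert! this using 1
        push_cast; simp; field_simp) (hIntg 0 hm)
      (by
        have : Continuous fun t => sin t ^ (n + 1) / (n + 1 : ℝ) := by fun_prop
        have h := (this.tendsto 0).mono_left (nhdsWithin_le_nhds (s := Ioi 0))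
        simpa using h)
      (by
        have : Continuous fun t => sin t ^ (n + 1) / (n + 1 : ℝ) := by fun_prop
        have h := (this.tendsto (π/2)).mono_left (nhdsWithin_le_nhds (s := Iio (π/2)))
        simpa using h)
    rw [h]; simp
  | succ m ih =>
    have ih := ih (by omega)
    have h1 := hIntg (m + 1) hm
    have h0 := hIntg m (by omega)
    have h := ftcE (F := fun t => sin t ^ (n + 1) * ls t ^ (m + 1)) (a := 0) (b := π / 2)
      (f := fun t => (n + 1 : ℝ) * (sin t ^ n * cos t * ls t ^ (m + 1))
        + (m + 1 : ℝ) * (sin t ^ n * cos t * ls t ^ m)) (A := 0) (B := 0) (by positivity)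
      (fun x hx => by
        have := ((hasDerivAt_sin x).pow (n + 1)).mul ((ls_hasDeriv hx).pow (m + 1))
        convert! this using 1
        have := (QI_sin_pos hx).ne'
        simp; field_simp; try ring)
      ((h1.const_mul _).add (h0.const_mul _))
      (sin_pow_ls_tendsto _ _ (by omega))
      (by
        have h := ((continuous_sin.tendsto (π/2)).mono_left
          (nhdsWithin_le_nhds (s := Iio (π/2)))).pow (n+1) |>.mul (ls_tendsto_half.pow (m+1))
        simpa using h)
    rw [integral_add (h1.const_mul _) (h0.const_mul _), integral_const_mul, integral_const_mul, ih] at h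
    have h2 : ∫ t in QI, sin t ^ n * cos t * ls t ^ (m + 1) =
      - ((m + 1 : ℝ) * ((-1) ^ m * m.factorial / (n + 1 : ℝ) ^ (m + 1))) / (n + 1) := by
      field_simp; field_simp at h; linarith
    rw [h2, Nat.factorial_succ]; push_cast; field_simp; ring

lemma log_moment (n m : ℕ) (hm : m ≤ 4) :
    ∫ t in Ioo (0:ℝ) 1, t ^ n * log t ^ m = (-1) ^ m * m.factorial / (n + 1 : ℝ) ^ (m + 1) := by
  have hIntg : ∀ m ≤ 4, IntegrableOn (fun t => t ^ n * log t ^ m) (Ioo (0:ℝ) 1) := fun m hm => by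
    refine Integrable.mono' log_bound_integrable (Measurable.aestronglyMeasurable (by fun_prop)) ?_
    filter_upwards [self_mem_ae_restrict measurableSet_Ioo] with x hx
    rw [norm_mul, norm_pow, norm_pow, Real.norm_eq_abs, Real.norm_eq_abs, abs_of_pos hx.1]
    have := pow_le_one_add (abs_nonneg (log x)) hm
    have h2 : x ^ n ≤ 1 := pow_le_one₀ hx.1.le hx.2.le
    calc _ ≤ 1 * |log x| ^ m := by gcongr
      _ ≤ _ := by linarith
  have hn : (n + 1 : ℝ) ≠ 0 := by positivity
  induction m with
  | zero =>
    have h := ftcE (F := fun t : ℝ => t ^ (n + 1) / (n + 1)) (a := 0) (b := 1)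
      (f := fun t => t ^ n * log t ^ 0) (A := 0) (B := 1 / (n + 1)) (by positivity)
      (fun x hx => by
        have := ((hasDerivAt_id x).pow (n + 1)).div_const (n + 1 : ℝ)
        convert! this using 1
        push_cast; simp; field_simp) (hIntg 0 hm)
      (by
        have : Continuous fun t : ℝ => t ^ (n + 1) / (n + 1 : ℝ) := by fun_prop
        have h := (this.tendsto 0).mono_left (nhdsWithin_le_nhds (s := Ioi 0))
        simpa using h)
      (by
        have : Continuous fun t : ℝ => t ^ (n + 1) / (n + 1 : ℝ) := by fun_prop
        have h := (this.tendsto 1).mono_left (nhdsWithin_le_nhds (s := Iio 1))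
        simpa using h)
    rw [h]; simp
  | succ m ih =>
    have ih := ih (by omega)
    have h1 := hIntg (m + 1) hm
    have h0 := hIntg m (by omega)
    have h := ftcE (F := fun t : ℝ => t ^ (n + 1) * log t ^ (m + 1)) (a := 0) (b := 1)
      (f := fun t => (n + 1 : ℝ) * (t ^ n * log t ^ (m + 1))
        + (m + 1 : ℝ) * (t ^ n * log t ^ m)) (A := 0) (B := 0) (by positivity)
      (fun x hx => by
        have := ((hasDerivAt_id x).pow (n + 1)).mul ((hasDerivAt_log hx.1.ne').pow (m + 1))
        convert! this using 1
        have := hx.1.ne'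
        simp; field_simp; try ring)
      ((h1.const_mul _).add (h0.const_mul _))
      (pow_log_tendsto _ _ (by omega))
      (by
        have hl : ContinuousAt (fun t : ℝ => t ^ (n + 1) * log t ^ (m + 1)) 1 :=
          (continuous_pow _).continuousAt.mul ((continuousAt_log one_ne_zero).pow _)
        have h := hl.tendsto.mono_left (nhdsWithin_le_nhds (s := Iio 1))
        simpa using h)
    rw [integral_add (h1.const_mul _) (h0.const_mul _), integral_const_mul, integral_const_mul, ih] at h
    have h2 : ∫ t in Ioo (0:ℝ) 1, t ^ n * log t ^ (m + 1) =
      - ((m + 1 : ℝ) * ((-1) ^ m * m.factorial / (n + 1 : ℝ) ^ (m + 1))) / (n + 1) := by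
      field_simp; field_simp at h; linarith
    rw [h2, Nat.factorial_succ]; push_cast; field_simp; ring

/-- `cos` moments of powers of `log sin`. -/
noncomputable def cm (m n : ℕ) : ℝ := ∫ t in QI, cos t ^ (2 * n + 1) * sin t * ls t ^ m

lemma cm_int (m n : ℕ) (hm : m ≤ 4) :
    IntegrableOn (fun t => cos t ^ (2 * n + 1) * sin t * ls t ^ m) QI :=
  intQ_mul 1 m hm (by fun_prop) (fun t _ => by
      rw [abs_mul, abs_pow]
      exact mul_le_one₀ (pow_le_one₀ (abs_nonneg _) (abs_cos_le_one t)) (abs_nonneg _)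
        (abs_sin_le_one t))

lemma cm_zero (n : ℕ) : cm 0 n = 1 / (2 * n + 2) := by
  have hn : (2 * n + 2 : ℝ) ≠ 0 := by positivity
  have h := ftcE (F := fun t => - cos t ^ (2 * n + 2) / (2 * n + 2)) (a := 0) (b := π / 2)
      (f := fun t => cos t ^ (2 * n + 1) * sin t * ls t ^ 0) (A := -1 / (2 * n + 2)) (B := 0)
      (by positivity)
      (fun x hx => by
        have := ((hasDerivAt_cos x).pow (2 * n + 2)).neg.div_const (2 * n + 2 : ℝ)
        convert! this using 1
        push_cast; simp; field_simp) (cm_int 0 n (by omega))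
      (by
        have : Continuous fun t => - cos t ^ (2 * n + 2) / (2 * n + 2 : ℝ) := by fun_prop
        have h := (this.tendsto 0).mono_left (nhdsWithin_le_nhds (s := Ioi 0))
        simpa using h)
      (by
        have : Continuous fun t => - cos t ^ (2 * n + 2) / (2 * n + 2 : ℝ) := by fun_prop
        have h := (this.tendsto (π/2)).mono_left (nhdsWithin_le_nhds (s := Iio (π/2)))
        simpa using h)
  unfold cm
  rw [h]; ring

lemma cm_rec0' (m n : ℕ) (hn : n = 0) (hm : m + 1 ≤ 4) :
    2 * cm (m + 1) n + (m + 1) * cm m n = 0 := by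
  have h1 := cm_int (m + 1) n hm
  have h0 := cm_int m n (by omega)
  have h1' : IntegrableOn (fun t => 2 * (cos t ^ (2 * n + 1) * sin t * ls t ^ (m + 1))) QI :=
    h1.const_mul (2:ℝ)
  have h0' : IntegrableOn (fun t => (m + 1 : ℝ) * (cos t ^ (2 * n + 1) * sin t * ls t ^ m)) QI :=
    h0.const_mul (m + 1 : ℝ)
  have h := ftcE (F := fun t => sin t ^ 2 * ls t ^ (m + 1)) (a := 0) (b := π / 2)
      (f := fun t => 2 * (cos t ^ (2 * n + 1) * sin t * ls t ^ (m + 1))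
        + (m + 1 : ℝ) * (cos t ^ (2 * n + 1) * sin t * ls t ^ m)) (A := 0) (B := 0) (by positivity)
      (fun x hx => by
        have := ((hasDerivAt_sin x).pow 2).mul ((ls_hasDeriv hx).pow (m + 1))
        convert! this using 1
        have := (QI_sin_pos hx).ne'
        simp [hn]; field_simp; try ring)
      (Integrable.add h1' h0')
      (sin_pow_ls_tendsto _ _ (by omega))
      (by
        have h := ((continuous_sin.tendsto (π/2)).mono_left
          (nhdsWithin_le_nhds (s := Iio (π/2)))).pow 2 |>.mul (ls_tendsto_half.pow (m+1))
        simpa using h)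
  rw [integral_add (h1.const_mul _) (h0.const_mul _), integral_const_mul, integral_const_mul] at h
  unfold cm; linarith

lemma cm_rec0 (m : ℕ) (hm : m + 1 ≤ 4) : 2 * cm (m + 1) 0 + (m + 1) * cm m 0 = 0 :=
  cm_rec0' m 0 rfl hm

lemma cm_rec (m n : ℕ) (hm : m + 1 ≤ 4) :
    (2 * n + 4) * cm (m + 1) (n + 1) - (2 * n + 2) * cm (m + 1) n + (m + 1) * cm m (n + 1) = 0 := by
  have h1 := cm_int (m + 1) (n + 1) hm
  have h2 := cm_int (m + 1) n hm
  have h0 := cm_int m (n + 1) (by omega)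
  have h12 : IntegrableOn (fun t => (2 * n + 4 : ℝ) * (cos t ^ (2 * (n + 1) + 1) * sin t * ls t ^ (m + 1))
        - (2 * n + 2 : ℝ) * (cos t ^ (2 * n + 1) * sin t * ls t ^ (m + 1))) QI :=
    (h1.const_mul (2 * n + 4 : ℝ)).sub (h2.const_mul (2 * n + 2 : ℝ))
  have h := ftcE (F := fun t => cos t ^ (2 * n + 2) * (sin t ^ 2 * ls t ^ (m + 1))) (a := 0)
      (b := π / 2)
      (f := fun t => ((2 * n + 4 : ℝ) * (cos t ^ (2 * (n + 1) + 1) * sin t * ls t ^ (m + 1))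
        - (2 * n + 2 : ℝ) * (cos t ^ (2 * n + 1) * sin t * ls t ^ (m + 1)))
        + (m + 1 : ℝ) * (cos t ^ (2 * (n + 1) + 1) * sin t * ls t ^ m)) (A := 0) (B := 0)
      (by positivity)
      (fun x hx => by
        have := ((hasDerivAt_cos x).pow (2 * n + 2)).mul
          (((hasDerivAt_sin x).pow 2).mul ((ls_hasDeriv hx).pow (m + 1)))
        convert! this using 1
        have hs := (QI_sin_pos hx).ne'
        have h3 : sin x ^ 2 = 1 - cos x ^ 2 := sin_sq x
        simp only [Nat.add_sub_cancel, show 2 * n + 2 - 1 = 2 * n + 1 by omega, Pi.pow_apply,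
          Pi.mul_apply]
        push_cast
        field_simp
        rw [h3]
        ring)
      (h12.add (h0.const_mul (m + 1 : ℝ)))
      (by
        have h := ((continuous_cos.tendsto 0).mono_left
          (nhdsWithin_le_nhds (s := Ioi 0))).pow (2 * n + 2) |>.mul
          (sin_pow_ls_tendsto 2 (m+1) (by omega))
        simpa using h)
      (by
        have h := ((continuous_sin.tendsto (π/2)).mono_left
          (nhdsWithin_le_nhds (s := Iio (π/2)))).pow 2 |>.mul (ls_tendsto_half.pow (m+1))
        have h' := ((continuous_cos.tendsto (π/2)).mono_left
          (nhdsWithin_le_nhds (s := Iio (π/2)))).pow (2 * n + 2) |>.mul h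
        simpa using h')
  rw [integral_add h12 (h0.const_mul _),
    integral_sub (h1.const_mul _) (h2.const_mul _), integral_const_mul, integral_const_mul,
    integral_const_mul] at h
  unfold cm; linarith

lemma gh_succ (k m : ℕ) : genHarmonic (k + 1) m = genHarmonic k m + 1 / (k + 1 : ℝ) ^ m := by
  unfold genHarmonic; rw [Finset.sum_range_succ]

lemma gh_zero (m : ℕ) : genHarmonic 0 m = 0 := by simp [genHarmonic]

lemma cm_one (n : ℕ) : (2 * n + 2) * cm 1 n = - genHarmonic (n + 1) 1 / 2 := by
  induction n with
  | zero =>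
    have := cm_rec0 0 (by omega)
    rw [cm_zero] at this
    rw [gh_succ, gh_zero]; push_cast at this ⊢; norm_num at this ⊢; linarith
  | succ n ih =>
    have := cm_rec 0 n (by omega)
    rw [cm_zero] at this
    have e : (1:ℝ) / (2 * (n + 1) + 2) = 1 / (n + 1 + 1) / 2 := by field_simp; 
    rw [gh_succ]; push_cast at this ⊢; norm_num at this e ⊢
    rw [e] at this
    linarith

lemma cm_two (n : ℕ) : (2 * n + 2) * cm 2 n
    = (genHarmonic (n + 1) 1 ^ 2 + genHarmonic (n + 1) 2) / 4 := by
  induction n with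
  | zero =>
    have h := cm_rec0 1 (by omega)
    have h1 := cm_one 0
    rw [gh_succ, gh_zero] at *; push_cast at *; norm_num at *
    rw [gh_succ, gh_zero]; norm_num; linarith
  | succ n ih =>
    have h := cm_rec 1 n (by omega)
    have h1 := cm_one (n + 1)
    have hc : cm 1 (n + 1) = - genHarmonic (n + 2) 1 / 2 / (2 * (n + 1) + 2) := by
      rw [eq_div_iff (by positivity)]; push_cast at h1; linarith
    norm_num at h
    rw [hc] at h
    rw [show n + 1 + 1 = n + 2 by rfl]
    rw [gh_succ (n + 1) 1] at h ⊢
    rw [gh_succ (n + 1) 2]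
    push_cast at *
    have : (2 * (n + 1 : ℝ) + 2) * cm 2 (n + 1) =
        (genHarmonic (n + 1) 1 ^ 2 + genHarmonic (n + 1) 2) / 4 +
        2 * (genHarmonic (n + 1) 1 + 1 / (n + 1 + 1) ^ 1) / 2 / (2 * (n + 1) + 2) := by
      rw [← ih]; linear_combination h
    rw [this]; field_simp; ring

/-- `4^n / C(2n,n)`. -/
noncomputable def bb (n : ℕ) : ℝ := 4 ^ n / (Nat.centralBinom n : ℝ)

lemma bb_pos (n : ℕ) : 0 < bb n := by
  have := Nat.centralBinom_pos n
  unfold bb; positivity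

lemma bb_succ (n : ℕ) : bb (n + 1) * (2 * n + 1) = bb n * (2 * (n + 1)) := by
  have h : ((n:ℝ) + 1) * (Nat.centralBinom (n + 1)) = 2 * (2 * n + 1) * Nat.centralBinom n := by
    exact_mod_cast Nat.succ_mul_centralBinom_succ n
  have h1 : (0:ℝ) < Nat.centralBinom n := by exact_mod_cast Nat.centralBinom_pos n
  have h2 : (0:ℝ) < Nat.centralBinom (n + 1) := by exact_mod_cast Nat.centralBinom_pos (n + 1)
  unfold bb
  rw [div_mul_eq_mul_div, div_mul_eq_mul_div, div_eq_div_iff h2.ne' h1.ne', pow_succ]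
  linear_combination (-2 * 4 ^ n) * h

lemma bb_le (n : ℕ) : bb n ≤ 2 * n + 1 := by
  rcases Nat.eq_zero_or_pos n with rfl | hn
  · simp [bb]
  have h : (4:ℝ) ^ n ≤ 2 * n * Nat.centralBinom n := by
    exact_mod_cast Nat.four_pow_le_two_mul_self_mul_centralBinom n hn
  have h1 : (0:ℝ) < Nat.centralBinom n := by exact_mod_cast Nat.centralBinom_pos n
  unfold bb
  rw [div_le_iff₀ h1]; nlinarith

/-- partial sums -/
noncomputable def sS (n : ℕ) (t : ℝ) : ℝ :=
  ∑ j ∈ Finset.range n, bb (j + 1) / (j + 1) * (sin t ^ (2 * j + 1) * cos t)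

noncomputable def sP (n : ℕ) (t : ℝ) : ℝ :=
  ∑ j ∈ Finset.range n, bb (j + 1) / (j + 1) ^ 2 * sin t ^ (2 * j + 2)

noncomputable def sT (n : ℕ) (t : ℝ) : ℝ :=
  ∑ j ∈ Finset.range n, bb (j + 1) * genHarmonic j 2 / (j + 1) * (sin t ^ (2 * j + 1) * cos t)

lemma sincos_deriv (j : ℕ) (t : ℝ) : HasDerivAt (fun t => sin t ^ (2 * j + 1) * cos t)
    ((2 * j + 1) * sin t ^ (2 * j) - (2 * j + 2) * sin t ^ (2 * j + 2)) t := by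
  have := ((hasDerivAt_sin t).pow (2 * j + 1)).mul (hasDerivAt_cos t)
  convert! this using 1
  simp only [Nat.add_sub_cancel, Pi.pow_apply]
  push_cast
  linear_combination (-(2 * j + 1) * sin t ^ (2 * j)) * (sin_sq_add_cos_sq t)

lemma bb_term (j : ℕ) (t : ℝ) : bb (j + 1) / (j + 1) *
    ((2 * j + 1) * sin t ^ (2 * j) - (2 * j + 2) * sin t ^ (2 * j + 2)) =
    2 * bb j * sin t ^ (2 * j) - 2 * bb (j + 1) * sin t ^ (2 * (j + 1)) := by
  have h := bb_succ j
  have h1 : bb (j + 1) / (j + 1) * (2 * j + 1) = 2 * bb j := by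
    rw [div_mul_eq_mul_div, h]; field_simp
  have h2 : bb (j + 1) / (j + 1) * (2 * j + 2) = 2 * bb (j + 1) := by
    field_simp
  rw [mul_sub, ← mul_assoc, ← mul_assoc, h1, h2]; ring

lemma sS_deriv (n : ℕ) (t : ℝ) : HasDerivAt (sS n) (2 - 2 * bb n * sin t ^ (2 * n)) t := by
  induction n with
  | zero =>
    have : sS 0 = fun _ => 0 := by ext; simp [sS]
    rw [this]; convert! hasDerivAt_const t (0:ℝ) using 1; simp [bb]
  | succ n ih =>
    have h := ih.add ((sincos_deriv n t).const_mul (bb (n + 1) / (n + 1)))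
    have e : sS (n + 1) = (sS n + fun t => bb (n + 1) / (n + 1) * (sin t ^ (2 * n + 1) * cos t)) := by
      ext t; simp [sS, Finset.sum_range_succ]
    rw [e]; convert! h using 1
    rw [bb_term]; ring

lemma sP_deriv (n : ℕ) (t : ℝ) : HasDerivAt (sP n) (2 * sS n t) t := by
  have : 2 * sS n t = ∑ j ∈ Finset.range n, bb (j + 1) / (j + 1) ^ 2 *
      (((2 * j + 2 : ℕ) : ℝ) * sin t ^ (2 * j + 2 - 1) * cos t) := by
    rw [sS, Finset.mul_sum]
    refine Finset.sum_congr rfl fun j _ => ?_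
    rw [show 2 * j + 2 - 1 = 2 * j + 1 by omega]; push_cast; field_simp
  rw [this]
  exact HasDerivAt.fun_sum fun j _ => ((hasDerivAt_sin t).pow (2 * j + 2)).const_mul _

lemma sT_deriv (n : ℕ) (t : ℝ) : HasDerivAt (sT n)
    (2 * sP n t - 2 * genHarmonic n 2 * bb n * sin t ^ (2 * n)) t := by
  induction n with
  | zero =>
    have : sT 0 = fun _ => 0 := by ext; simp [sT]
    rw [this]; convert! hasDerivAt_const t (0:ℝ) using 1; simp [sP, gh_zero]
  | succ n ih =>
    have h := ih.add ((sincos_deriv n t).const_mul (bb (n + 1) * genHarmonic n 2 / (n + 1)))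
    have e : sT (n + 1) = (sT n + fun t => bb (n + 1) * genHarmonic n 2 / (n + 1) *
        (sin t ^ (2 * n + 1) * cos t)) := by
      ext t; simp [sT, Finset.sum_range_succ]
    rw [e]; convert! h using 1
    have e2 : sP (n + 1) t = sP n t + bb (n + 1) / (n + 1) ^ 2 * sin t ^ (2 * n + 2) := by
      simp [sP, Finset.sum_range_succ]
    rw [e2, gh_succ]
    linear_combination (-genHarmonic n 2) * bb_term n t

lemma gh2_nonneg (n m : ℕ) : 0 ≤ genHarmonic n m := by
  unfold genHarmonic; exact Finset.sum_nonneg fun _ _ => by positivity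

lemma gh2_le (n m : ℕ) : genHarmonic n m ≤ n := by
  unfold genHarmonic
  calc _ ≤ ∑ _j ∈ Finset.range n, (1:ℝ) := by
        refine Finset.sum_le_sum fun j _ => ?_
        rw [div_le_one (by positivity)]
        exact one_le_pow₀ (by linarith [(Nat.cast_nonneg j : (0:ℝ) ≤ j)])
    _ = n := by simp

lemma mvt_bound {F G F' G' : ℝ → ℝ} {T e : ℝ} (hT : 0 ≤ T)
    (hF : ∀ x, HasDerivAt F (F' x) x) (hG : ∀ x, HasDerivAt G (G' x) x)
    (h0 : F 0 = G 0) (hb : ∀ x ∈ Icc 0 T, |F' x - G' x| ≤ e) :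
    ∀ x ∈ Icc 0 T, |F x - G x| ≤ e * T := by
  intro x hx
  have h := (convex_Icc (0:ℝ) T).norm_image_sub_le_of_norm_hasDerivWithin_le
    (f := fun x => F x - G x) (f' := fun x => F' x - G' x) (C := e)
    (fun x _ => ((hF x).sub (hG x)).hasDerivWithinAt) hb (left_mem_Icc.2 hT) hx
  simp only [h0, sub_self, sub_zero, Real.norm_eq_abs] at h
  refine h.trans ?_
  have he : 0 ≤ e := (abs_nonneg _).trans (hb x hx)
  rw [abs_of_nonneg hx.1]; gcongr; exact hx.2

lemma err_bound {T : ℝ} (hT : T ∈ QI) (n : ℕ) : ∀ x ∈ Icc 0 T,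
    0 ≤ bb n * sin x ^ (2 * n) ∧ bb n * sin x ^ (2 * n) ≤ bb n * sin T ^ (2 * n) := by
  intro x hx
  have h0 : 0 ≤ sin x := sin_nonneg_of_nonneg_of_le_pi hx.1 (by linarith [hx.2, hT.2, pi_pos])
  have h1 : sin x ≤ sin T := by
    apply sin_le_sin_of_le_of_le_pi_div_two <;> linarith [hx.1, hx.2, hT.1, hT.2, pi_pos]
  have := bb_pos n
  exact ⟨by positivity, by gcongr⟩

lemma sS_bound {T : ℝ} (hT : T ∈ QI) (n : ℕ) : ∀ x ∈ Icc 0 T,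
    |sS n x - 2 * x| ≤ (2 * (bb n * sin T ^ (2 * n))) * T := by
  refine mvt_bound hT.1.le (fun x => sS_deriv n x)
    (fun x => by simpa using (hasDerivAt_id x).const_mul (2:ℝ)) (by simp [sS]) fun x hx => ?_
  have := err_bound hT n x hx
  rw [abs_le]; constructor <;> nlinarith

lemma sP_bound {T : ℝ} (hT : T ∈ QI) (n : ℕ) : ∀ x ∈ Icc 0 T,
    |sP n x - 2 * x ^ 2| ≤ (2 * ((2 * (bb n * sin T ^ (2 * n))) * T)) * T := by
  refine mvt_bound hT.1.le (fun x => sP_deriv n x)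
    (G' := fun x => 4 * x)
    (fun x => by
      have := (hasDerivAt_pow 2 x).const_mul (2:ℝ)
      convert! this using 1; push_cast; ring) (by simp [sP]) fun x hx => ?_
  have := sS_bound hT n x hx
  rw [abs_le] at this ⊢; constructor <;> linarith

lemma sT_bound {T : ℝ} (hT : T ∈ QI) (n : ℕ) : ∀ x ∈ Icc 0 T,
    |sT n x - 4 / 3 * x ^ 3| ≤ (2 * ((2 * ((2 * (bb n * sin T ^ (2 * n))) * T)) * T)
      + 2 * n * (bb n * sin T ^ (2 * n))) * T := by
  refine mvt_bound hT.1.le (fun x => sT_deriv n x)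
    (G' := fun x => 4 * x ^ 2)
    (fun x => by
      have := (hasDerivAt_pow 3 x).const_mul (4/3:ℝ)
      convert! this using 1; push_cast; ring) (by simp [sT]) fun x hx => ?_
  have h1 := sP_bound hT n x hx
  have h2 := err_bound hT n x hx
  have h3 := gh2_nonneg n 2
  have h4 := gh2_le n 2
  have h5 : genHarmonic n 2 * (bb n * sin x ^ (2 * n)) ≤ n * (bb n * sin T ^ (2 * n)) :=
    mul_le_mul h4 h2.2 h2.1 (by positivity)
  have h6 : 0 ≤ genHarmonic n 2 * (bb n * sin x ^ (2 * n)) := mul_nonneg h3 h2.1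
  rw [abs_le] at h1 ⊢; constructor <;> linarith

lemma err_tendsto {T : ℝ} (hT : T ∈ QI) :
    Tendsto (fun n : ℕ => bb n * sin T ^ (2 * n)) atTop (𝓝 0) ∧
    Tendsto (fun n : ℕ => n * (bb n * sin T ^ (2 * n))) atTop (𝓝 0) := by
  have hs := QI_sin_pos hT
  have hr : sin T ^ 2 < 1 := by
    have := QI_cos_pos hT; nlinarith [sin_sq_add_cos_sq T]
  have hr0 : 0 ≤ sin T ^ 2 := by positivity
  have h0 := tendsto_pow_const_mul_const_pow_of_lt_one 0 hr0 hr
  have h1 := tendsto_pow_const_mul_const_pow_of_lt_one 1 hr0 hr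
  have h2 := tendsto_pow_const_mul_const_pow_of_lt_one 2 hr0 hr
  have hA := (h1.const_mul 2).add h0
  have hB := (h2.const_mul 2).add h1
  simp only [mul_zero, add_zero] at hA hB
  constructor
  · refine squeeze_zero (fun n => by have := bb_pos n; positivity) (fun n => ?_) hA
    have h := bb_le n
    rw [pow_mul]
    have : 0 ≤ (sin T ^ 2) ^ n := by positivity
    simp only [pow_zero, pow_one]; nlinarith
  · refine squeeze_zero (fun n => by have := bb_pos n; positivity) (fun n => ?_) hB
    have h := bb_le n
    rw [pow_mul]
    have h3 : 0 ≤ (n:ℝ) * (sin T ^ 2) ^ n := by positivity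
    simp only [pow_one]; nlinarith

lemma tendsto_of_bound {u e : ℕ → ℝ} {a : ℝ} (h : ∀ n, |u n - a| ≤ e n)
    (he : Tendsto e atTop (𝓝 0)) : Tendsto u atTop (𝓝 a) := by
  rw [tendsto_iff_norm_sub_tendsto_zero]
  exact squeeze_zero (fun _ => norm_nonneg _) h he

lemma hasSum_S {T : ℝ} (hT : T ∈ QI) :
    HasSum (fun j : ℕ => bb (j + 1) / (j + 1) * (sin T ^ (2 * j + 1) * cos T)) (2 * T) := by
  have hs := QI_sin_pos hT
  have hc := QI_cos_pos hT
  rw [hasSum_iff_tendsto_nat_of_nonneg (fun j => by have := bb_pos (j + 1); positivity)]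
  refine tendsto_of_bound (fun n => sS_bound hT n T (right_mem_Icc.2 hT.1.le)) ?_
  have := ((err_tendsto hT).1.const_mul 2).mul_const T
  simpa using this

lemma hasSum_P {T : ℝ} (hT : T ∈ QI) :
    HasSum (fun j : ℕ => bb (j + 1) / (j + 1) ^ 2 * sin T ^ (2 * j + 2)) (2 * T ^ 2) := by
  have hs := QI_sin_pos hT
  have hc := QI_cos_pos hT
  rw [hasSum_iff_tendsto_nat_of_nonneg (fun j => by have := bb_pos (j + 1); positivity)]
  refine tendsto_of_bound (fun n => sP_bound hT n T (right_mem_Icc.2 hT.1.le)) ?_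
  have := ((((err_tendsto hT).1.const_mul 2).mul_const T).const_mul 2).mul_const T
  simpa using this

lemma hasSum_T {T : ℝ} (hT : T ∈ QI) :
    HasSum (fun j : ℕ => bb (j + 1) * genHarmonic j 2 / (j + 1) * (sin T ^ (2 * j + 1) * cos T))
      (4 / 3 * T ^ 3) := by
  have hs := QI_sin_pos hT
  have hc := QI_cos_pos hT
  rw [hasSum_iff_tendsto_nat_of_nonneg (fun j => by
    have := bb_pos (j + 1); have := gh2_nonneg j 2; positivity)]
  refine tendsto_of_bound (fun n => sT_bound hT n T (right_mem_Icc.2 hT.1.le)) ?_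
  have h1 := ((((err_tendsto hT).1.const_mul 2).mul_const T).const_mul 2).mul_const T
  have h2 := ((h1.const_mul 2).add ((err_tendsto hT).2.const_mul 2)).mul_const T
  simp only [mul_zero, zero_mul, add_zero] at h2
  refine h2.congr fun n => ?_
  ring

/-- termwise integration for nonnegative series with integrable sum. -/
lemma hasSum_int {s : Set ℝ} (hs : MeasurableSet s) {F : ℕ → ℝ → ℝ} {f : ℝ → ℝ}
    (hm : ∀ n, ContinuousOn (F n) s) (h0 : ∀ n, ∀ x ∈ s, 0 ≤ F n x)
    (hf : ∀ x ∈ s, HasSum (fun n => F n x) (f x)) (hi : IntegrableOn f s) :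
    HasSum (fun n => ∫ x in s, F n x) (∫ x in s, f x) := by
  refine hasSum_integral_of_dominated_convergence F (fun n => (hm n).aestronglyMeasurable hs) ?_ ?_ ?_ ?_
  · intro n
    filter_upwards [self_mem_ae_restrict hs] with x hx
    rw [norm_of_nonneg (h0 n x hx)]
  · filter_upwards [self_mem_ae_restrict hs] with x hx using (hf x hx).summable
  · refine hi.congr ?_
    filter_upwards [self_mem_ae_restrict hs] with x hx using (hf x hx).tsum_eq.symm
  · filter_upwards [self_mem_ae_restrict hs] with x hx using hf x hx

lemma hasSum_cg {f g : ℕ → ℝ} {a b : ℝ} (h : HasSum f a) (hfg : ∀ n, g n = f n) (hab : b = a) :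
    HasSum g b := by
  rw [hab, show g = f from funext hfg]; exact h

lemma QI_flip {t : ℝ} (ht : t ∈ QI) : π / 2 - t ∈ QI := ⟨by linarith [ht.2], by linarith [ht.1]⟩

lemma QI_abs {t : ℝ} (ht : t ∈ QI) : |t| ≤ 2 := by
  rw [abs_of_pos ht.1]; linarith [ht.2, pi_lt_four]

lemma psi_abs {t : ℝ} (ht : t ∈ QI) : |t - π/2| ≤ 2 := by
  rw [abs_sub_comm]; exact QI_abs (QI_flip ht)

lemma psi_tan {t : ℝ} (ht : t ∈ QI) : |(t - π/2) * tan t| ≤ 1 := by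
  have h := QI_flip ht
  have hc := QI_cos_pos ht
  have hs := QI_sin_pos ht
  rw [tan_eq_sin_div_cos, ← mul_div_assoc, abs_div, abs_of_pos hc, div_le_one hc, abs_mul,
    abs_sub_comm, abs_of_pos h.1, abs_of_pos hs]
  have h1 := Real.lt_tan h.1 h.2
  rw [tan_pi_div_two_sub, tan_eq_sin_div_cos, inv_div, lt_div_iff₀ hs] at h1
  exact h1.le

lemma psi_cont : ContinuousOn (fun t : ℝ => t - π/2) QI := by fun_prop

lemma int_B : IntegrableOn (fun t => tan t * (t - π/2) ^ 2 * ls t ^ 2) QI := by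
  refine intQ_mul 2 2 (by norm_num) (tan_cont.mul (psi_cont.pow 2)) fun t ht => ?_
  rw [show tan t * (t - π/2) ^ 2 = ((t - π/2) * tan t) * (t - π/2) by ring, abs_mul]
  have := psi_tan ht; have := psi_abs ht
  calc _ ≤ 1 * (2:ℝ) := by gcongr
    _ = 2 := by norm_num

lemma int_pl (i k : ℕ) (hk : k ≤ 4) : IntegrableOn (fun t => t ^ i * ls t ^ k) QI := by
  refine intQ_mul (2 ^ i) k hk (by fun_prop) fun t ht => ?_
  rw [abs_pow]; have := QI_abs ht; gcongr

lemma sum_B : HasSum (fun j : ℕ => bb (j + 1) / (j + 1) ^ 2 * cm 2 j)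
    (2 * ∫ t in QI, tan t * (t - π/2) ^ 2 * ls t ^ 2) := by
  have h := hasSum_int (s := QI) measurableSet_Ioo
    (F := fun j t => bb (j + 1) / (j + 1) ^ 2 * (cos t ^ (2 * j + 1) * sin t * ls t ^ 2))
    (f := fun t => 2 * (tan t * (t - π/2) ^ 2 * ls t ^ 2))
    (fun j => by have := ls_cont; fun_prop)
    (fun j t ht => by
      have := bb_pos (j + 1); have := QI_cos_pos ht; have := QI_sin_pos ht; positivity)
    (fun t ht => by
      have h := (hasSum_P (QI_flip ht)).mul_right (tan t * ls t ^ 2)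
      have hc := (QI_cos_pos ht).ne'
      refine hasSum_cg h (fun j => ?_) ?_
      · rw [sin_pi_div_two_sub, tan_eq_sin_div_cos]; field_simp; ring
      · ring) (int_B.const_mul 2)
  rw [integral_const_mul] at h
  simp_rw [integral_const_mul] at h
  exact h

lemma sum_D : HasSum (fun j : ℕ => bb (j + 1) / (j + 1) ^ 5)
    (-(16 / 3) * ∫ t in QI, t * ls t ^ 3) := by
  have h := hasSum_int (s := QI) measurableSet_Ioo
    (F := fun j t => (-(bb (j + 1) / (j + 1))) * (sin t ^ (2 * j + 1) * cos t * ls t ^ 3))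
    (f := fun t => (-2) * (t ^ 1 * ls t ^ 3))
    (fun j => by have := ls_cont; fun_prop)
    (fun j t ht => by
      have := bb_pos (j + 1); have := QI_cos_pos ht; have := QI_sin_pos ht
      have h3 : 0 ≤ (- ls t) ^ 3 := pow_nonneg (by linarith [ls_nonpos ht]) 3
      have : 0 ≤ bb (j + 1) / (j + 1) * (sin t ^ (2 * j + 1) * cos t * (-ls t) ^ 3) := by positivity
      convert! this using 1; ring)
    (fun t ht => by
      have h := (hasSum_S ht).mul_right (-ls t ^ 3)
      refine hasSum_cg h (fun j => ?_) ?_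
      · ring
      · ring) ((int_pl 1 3 (by norm_num)).const_mul (-2))
  rw [integral_const_mul] at h
  simp_rw [integral_const_mul, sin_moment _ 3 (by norm_num)] at h
  have h' := h.mul_left (8/3)
  simp only [pow_one] at h'
  refine hasSum_cg h' (fun j => ?_) ?_
  · rw [show ((2 * j + 1 : ℕ) : ℝ) + 1 = 2 * (j + 1) by push_cast; ring]
    simp only [Nat.factorial]
    push_cast
    field_simp
    try norm_num
    try ring
  · ring

lemma sum_A : HasSum (fun j : ℕ => bb (j + 1) * genHarmonic j 2 / (j + 1) ^ 3)
    (-(16 / 3) * ∫ t in QI, t ^ 3 * ls t) := by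
  have h := hasSum_int (s := QI) measurableSet_Ioo
    (F := fun j t => (-(bb (j + 1) * genHarmonic j 2 / (j + 1))) * (sin t ^ (2 * j + 1) * cos t * ls t ^ 1))
    (f := fun t => (-(4/3)) * (t ^ 3 * ls t ^ 1))
    (fun j => by have := ls_cont; fun_prop)
    (fun j t ht => by
      have := bb_pos (j + 1); have := QI_cos_pos ht; have := QI_sin_pos ht
      have h3 : 0 ≤ (- ls t) := (by linarith [ls_nonpos ht])
      have := gh2_nonneg j 2
      have : 0 ≤ bb (j + 1) * genHarmonic j 2 / (j + 1) * (sin t ^ (2 * j + 1) * cos t * (-ls t)) := by positivity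
      convert! this using 1; ring)
    (fun t ht => by
      have h := (hasSum_T ht).mul_right (-ls t)
      refine hasSum_cg h (fun j => ?_) ?_
      · ring
      · ring) ((int_pl 3 1 (by norm_num)).const_mul (-(4/3)))
  rw [integral_const_mul] at h
  simp_rw [integral_const_mul, sin_moment _ 1 (by norm_num)] at h
  have h' := h.mul_left 4
  simp only [pow_one] at h'
  refine hasSum_cg h' (fun j => ?_) ?_
  · rw [show ((2 * j + 1 : ℕ) : ℝ) + 1 = 2 * (j + 1) by push_cast; ring]
    simp only [Nat.factorial]
    push_cast
    field_simp
    try norm_num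
    try ring
  · ring

theorem main_series : ∑' k : ℕ, (4 : ℝ) ^ (k + 1) * (genHarmonic (k + 1) 1) ^ 2 /
      ((k + 1 : ℝ) ^ 3 * (Nat.choose (2 * (k + 1)) (k + 1) : ℝ))
    = 16 * (∫ t in QI, tan t * (t - π/2) ^ 2 * ls t ^ 2)
      + 16 / 3 * (∫ t in QI, t ^ 3 * ls t) + 16 / 3 * ∫ t in QI, t * ls t ^ 3 := by
  have h := ((sum_B.mul_left 8).sub sum_A).sub sum_D
  have e : (fun k : ℕ => (4 : ℝ) ^ (k + 1) * (genHarmonic (k + 1) 1) ^ 2 /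
      ((k + 1 : ℝ) ^ 3 * (Nat.choose (2 * (k + 1)) (k + 1) : ℝ))) = fun j : ℕ =>
      8 * (bb (j + 1) / (j + 1) ^ 2 * cm 2 j) - bb (j + 1) * genHarmonic j 2 / (j + 1) ^ 3
      - bb (j + 1) / (j + 1) ^ 5 := by
    ext j
    have h2 := cm_two j
    have hc : cm 2 j = (genHarmonic (j + 1) 1 ^ 2 + genHarmonic (j + 1) 2) / 4 / (2 * j + 2) := by
      rw [eq_div_iff (by positivity)]; linarith
    rw [hc, gh_succ j 2]
    have hb : (0:ℝ) < Nat.centralBinom (j + 1) := by exact_mod_cast Nat.centralBinom_pos (j + 1)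
    unfold bb
    rw [← Nat.centralBinom_eq_two_mul_choose]
    field_simp
    ring
  rw [e, h.tsum_eq]; ring

/-- the contour -/
noncomputable def wc (t : ℝ) : ℂ := ((sin t ^ 2 : ℝ) : ℂ) - Complex.I * ((sin t * cos t : ℝ) : ℂ)

/-- its derivative -/
noncomputable def wd (t : ℝ) : ℂ := ((2 * sin t * cos t : ℝ) : ℂ) - Complex.I * ((cos t ^ 2 - sin t ^ 2 : ℝ) : ℂ)

lemma wc_re (t : ℝ) : (wc t).re = sin t ^ 2 := by
  simp only [wc, Complex.sub_re, Complex.ofReal_re, Complex.mul_re, Complex.I_re, Complex.I_im,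
    Complex.ofReal_im]; ring

lemma wc_im (t : ℝ) : (wc t).im = -(sin t * cos t) := by
  simp only [wc, Complex.sub_im, Complex.ofReal_re, Complex.mul_im, Complex.I_re, Complex.I_im,
    Complex.ofReal_im]; ring

lemma sin_sq_deriv (t : ℝ) : HasDerivAt (fun t => sin t ^ 2) (2 * sin t * cos t) t := by
  have := (hasDerivAt_sin t).pow 2
  convert! this using 1; simp

lemma wc_deriv (t : ℝ) : HasDerivAt wc (wd t) t := by
  have h1 := (sin_sq_deriv t).ofReal_comp
  have h2 := (((hasDerivAt_sin t).mul (hasDerivAt_cos t)).ofReal_comp).const_mul Complex.I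
  have h := h1.sub h2
  convert! h using 1
  rw [wd]; congr 3; ring

lemma wc_norm {t : ℝ} (ht : t ∈ QI) : ‖wc t‖ = sin t := by
  have hs := QI_sin_pos ht
  rw [Complex.norm_eq_sqrt_sq_add_sq, wc_re, wc_im, Real.sqrt_eq_iff_mul_self_eq (by positivity) hs.le]
  linear_combination (sin t ^ 2) * sin_sq_add_cos_sq t

lemma wc_mem {t : ℝ} (ht : t ∈ QI) : wc t ∈ Metric.ball (1:ℂ) 1 := by
  have hc := QI_cos_pos ht
  have hs := QI_sin_pos ht
  rw [mem_ball_iff_norm, Complex.norm_eq_sqrt_sq_add_sq, Complex.sub_re, Complex.sub_im, wc_re, wc_im]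
  rw [Real.sqrt_lt' one_pos]
  simp only [Complex.one_re, Complex.one_im]
  nlinarith [sin_sq_add_cos_sq t, pow_pos hs 2]

lemma sq_mem {t : ℝ} (ht : t ∈ QI) : ((sin t ^ 2 : ℝ) : ℂ) ∈ Metric.ball (1:ℂ) 1 := by
  have hc := QI_cos_pos ht
  have hs := QI_sin_pos ht
  rw [mem_ball_iff_norm, ← Complex.ofReal_one, ← Complex.ofReal_sub, Complex.norm_real, Real.norm_eq_abs,
    abs_lt]
  constructor <;> nlinarith [sin_sq_add_cos_sq t, pow_pos hs 2, pow_pos hc 2]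

lemma wc_log {t : ℝ} (ht : t ∈ QI) : Complex.log (wc t) = (ls t : ℂ) + ((t - π / 2 : ℝ) : ℂ) * Complex.I := by
  have hs := QI_sin_pos ht
  have e : wc t = Complex.exp ((ls t : ℂ) + ((t - π / 2 : ℝ) : ℂ) * Complex.I) := by
    rw [Complex.exp_add, ← Complex.ofReal_exp, ls, Real.exp_log hs, Complex.exp_mul_I,
      ← Complex.ofReal_cos, ← Complex.ofReal_sin, cos_sub_pi_div_two, sin_sub_pi_div_two, wc]
    push_cast; ring
  rw [e, Complex.log_exp]
  · simp; linarith [ht.1, pi_pos]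
  · simp; linarith [ht.2, pi_pos]

lemma tendsto_Ioo_right : ∀ᶠ t in 𝓝[<] (π/2), t ∈ QI := by
  exact Ioo_mem_nhdsLT (by positivity)

lemma tendsto_Ioo_left : ∀ᶠ t in 𝓝[>] (0:ℝ), t ∈ QI := by
  exact Ioo_mem_nhdsGT (by positivity)

lemma contour (g : ℂ → ℂ) (hg : DifferentiableOn ℂ g (Metric.ball 1 1)) (C : ℝ)
    (hb : ∀ v ∈ Metric.ball (1:ℂ) 1, ‖v‖ ≤ 1/4 → ‖g v‖ ≤ C * (1 + |log ‖v‖| ^ 4))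
    (φ : ℂ →L[ℝ] ℝ) (F : ℝ → ℝ) (hF : IntegrableOn F QI)
    (he : ∀ t ∈ QI, t ≠ π / 4 → F t = φ (g (wc t) * wd t
      - g ((sin t ^ 2 : ℝ) : ℂ) * ((2 * sin t * cos t : ℝ) : ℂ))) :
    ∫ t in QI, F t = 0 := by
  obtain ⟨G, hG⟩ := hg.isExactOn_ball
  set H : ℝ → ℂ := fun t => G (wc t) - G ((sin t ^ 2 : ℝ) : ℂ) with hH
  have hd : ∀ t ∈ QI, HasDerivAt H (g (wc t) * wd t
      - g ((sin t ^ 2 : ℝ) : ℂ) * ((2 * sin t * cos t : ℝ) : ℂ)) t := by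
    intro t ht
    have h1 := (hG _ (wc_mem ht)).comp_of_eq t (wc_deriv t) rfl
    have h2 := (hG _ (sq_mem ht)).comp_of_eq t (sin_sq_deriv t).ofReal_comp rfl
    exact h1.sub h2
  have hC : 0 ≤ C := by
    have h1 := hb (1/4) (by rw [mem_ball_iff_norm]; norm_num) (by norm_num)
    by_contra hC
    have : 0 < 1 + |log ‖(1/4:ℂ)‖| ^ 4 := by positivity
    nlinarith [norm_nonneg (g (1/4))]
  have l0 : Tendsto H (𝓝[>] 0) (𝓝 0) := by
    have hlim : Tendsto (fun t => C * (1 * sin t ^ 1 * ls t ^ 0 + 16 * (sin t ^ 1 * ls t ^ 4))) (𝓝[>] 0) (𝓝 0) := by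
      have h1 := sin_pow_ls_tendsto 1 0 (by norm_num)
      have h4 := sin_pow_ls_tendsto 1 4 (by norm_num)
      have := (h1.add (h4.const_mul 16)).const_mul C
      simpa using this
    refine squeeze_zero_norm' ?_ hlim
    have hsm : ∀ᶠ t in 𝓝[>] (0:ℝ), sin t < 1/4 :=
      (tendsto_nhdsWithin_iff.1 sin_tendsto_zero).1.eventually (gt_mem_nhds (by norm_num))
    filter_upwards [hsm, tendsto_Ioo_left] with t hst ht
    have hs := QI_sin_pos ht
    have hc := QI_cos_pos ht
    set S : Set ℂ := (Metric.ball 1 1 ∩ Metric.closedBall 0 (sin t)) ∩ {v | sin t ^ 2 ≤ v.re} with hS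
    have hconv : Convex ℝ S :=
      ((convex_ball _ _).inter (convex_closedBall _ _)).inter (convex_halfSpace_re_ge _)
    have hSw : wc t ∈ S := by
      refine ⟨⟨wc_mem ht, ?_⟩, ?_⟩
      · rw [mem_closedBall_zero_iff, wc_norm ht]
      · simp [wc_re]
    have hSs : ((sin t ^ 2 : ℝ) : ℂ) ∈ S := by
      refine ⟨⟨sq_mem ht, ?_⟩, ?_⟩
      · rw [mem_closedBall_zero_iff, Complex.norm_real, Real.norm_of_nonneg (by positivity)]
        nlinarith [sin_le_one t]
      · show sin t ^ 2 ≤ (((sin t ^ 2 : ℝ) : ℂ)).re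
        rw [Complex.ofReal_re]
    have hbd : ∀ v ∈ S, ‖g v‖ ≤ C * (1 + (2 * |ls t|) ^ 4) := by
      rintro v ⟨⟨hv1, hv2⟩, hv3⟩
      rw [mem_closedBall_zero_iff] at hv2
      have hv4 : sin t ^ 2 ≤ ‖v‖ := le_trans hv3 (Complex.re_le_norm v)
      have hp : 0 < ‖v‖ := lt_of_lt_of_le (by positivity) hv4
      refine (hb v hv1 (by linarith)).trans ?_
      have a1 : log ‖v‖ ≤ ls t := Real.log_le_log hp hv2
      have a2 : 2 * ls t ≤ log ‖v‖ := by
        have := Real.log_le_log (by positivity) hv4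
        rw [Real.log_pow] at this; exact_mod_cast this
      have a3 := ls_nonpos ht
      have : |log ‖v‖| ≤ 2 * |ls t| := by
        rw [abs_of_nonpos a3, abs_of_nonpos (by linarith)]; linarith
      gcongr
    have key := hconv.norm_image_sub_le_of_norm_hasDerivWithin_le (f := G) (f' := g)
      (fun v hv => (hG v hv.1.1).hasDerivWithinAt) hbd hSs hSw
    have e1 : ‖wc t - ((sin t ^ 2 : ℝ) : ℂ)‖ ≤ sin t := by
      rw [wc, sub_sub_cancel_left, norm_neg, norm_mul, Complex.norm_I, one_mul, Complex.norm_real,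
        Real.norm_of_nonneg (by positivity)]
      nlinarith [cos_le_one t]
    refine key.trans ?_
    have e2 : (2 * |ls t|) ^ 4 = 16 * ls t ^ 4 := by
      rw [mul_pow, pow_abs, abs_of_nonneg (by positivity)]; norm_num
    calc _ ≤ C * (1 + (2 * |ls t|) ^ 4) * sin t := by gcongr
      _ = _ := by rw [e2]; ring
  have l1 : Tendsto H (𝓝[<] (π/2)) (𝓝 0) := by
    have hG1 : ContinuousAt G 1 := (hG 1 (by simp)).continuousAt
    have w1 : wc (π/2) = 1 := by simp [wc]
    have s1 : ((sin (π/2) ^ 2 : ℝ) : ℂ) = 1 := by simp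
    have c1 : ContinuousAt (fun t => G (wc t)) (π/2) := by
      refine ContinuousAt.comp (g := G) ?_ (wc_deriv _).continuousAt
      rw [w1]; exact hG1
    have c2 : ContinuousAt (fun t : ℝ => G ((sin t ^ 2 : ℝ) : ℂ)) (π/2) := by
      refine ContinuousAt.comp (g := G) (f := fun t : ℝ => ((sin t ^ 2 : ℝ) : ℂ)) ?_ (by fun_prop)
      rw [s1]; exact hG1
    have := (c1.sub c2).tendsto.mono_left (nhdsWithin_le_nhds (s := Iio (π/2)))
    have e : G (wc (π/2)) - G ((sin (π/2) ^ 2 : ℝ) : ℂ) = 0 := by rw [w1, s1, sub_self]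
    rw [← e]; exact this
  have hae : ∀ᵐ t ∂(volume.restrict QI), F t = φ (g (wc t) * wd t
      - g ((sin t ^ 2 : ℝ) : ℂ) * ((2 * sin t * cos t : ℝ) : ℂ)) := by
    have h1 : ∀ᵐ t ∂(volume.restrict QI), t ≠ π / 4 := by
      refine ae_restrict_of_ae ?_
      simp [ae_iff]
    filter_upwards [self_mem_ae_restrict measurableSet_Ioo, h1] with t ht h1 using he t ht h1
  rw [integral_congr_ae hae]
  have := ftcE (F := fun t => φ (H t)) (f := fun t => φ (g (wc t) * wd t
      - g ((sin t ^ 2 : ℝ) : ℂ) * ((2 * sin t * cos t : ℝ) : ℂ))) (a := 0) (b := π/2) (A := 0) (B := 0)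
    (by positivity) (fun t ht => φ.hasFDerivAt.comp_hasDerivAt t (hd t ht)) (hF.congr hae) ?_ ?_
  · rw [this, sub_zero]
  · simpa [Function.comp_def] using (φ.continuous.tendsto 0).comp l0
  · simpa [Function.comp_def] using (φ.continuous.tendsto 0).comp l1

lemma log_pow_norm {v : ℂ} (m : ℕ) (hm : m ≤ 4) :
    ‖Complex.log v ^ m‖ ≤ 2048 * (1 + |log ‖v‖| ^ 4) := by
  have h : ‖Complex.log v‖ ≤ |log ‖v‖| + 4 := by
    have h1 := Complex.norm_le_abs_re_add_abs_im (Complex.log v)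
    rw [Complex.log_re, Complex.log_im] at h1
    linarith [Complex.abs_arg_le_pi v, pi_lt_four]
  set a := |log ‖v‖| with ha
  have ha0 : 0 ≤ a := abs_nonneg _
  rw [norm_pow]
  calc _ ≤ (a + 4) ^ m := by gcongr
    _ ≤ (a + 4) ^ 4 := pow_le_pow_right₀ (by linarith) hm
    _ ≤ _ := by nlinarith [sq_nonneg (a - 4), sq_nonneg (a ^ 2 - 16), sq_nonneg a, sq_nonneg (a^2-4*a), mul_nonneg ha0 (sq_nonneg (a-4))]

lemma log_pow_diff (m : ℕ) : DifferentiableOn ℂ (fun v => Complex.log v ^ m) (Metric.ball 1 1) := by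
  intro v hv
  refine DifferentiableAt.differentiableWithinAt ?_
  refine (Complex.differentiableAt_log ?_).pow m
  exact Complex.ball_one_subset_slitPlane hv

lemma contour_dslope (m : ℕ) (hm : m ≤ 4) (c : ℝ) (hc : 1/2 ≤ c) (hc1 : c ≤ 1)
    (φ : ℂ →L[ℝ] ℝ) (F : ℝ → ℝ) (hF : IntegrableOn F QI)
    (he : ∀ t ∈ QI, sin t ^ 2 ≠ c → F t = φ
      ((((ls t : ℂ) + ((t - π / 2 : ℝ) : ℂ) * Complex.I) ^ m - (log c : ℂ) ^ m) / (wc t - c) * wd t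
      - (((((2 * ls t) ^ m - log c ^ m) / (sin t ^ 2 - c) * (2 * sin t * cos t) : ℝ)) : ℂ)))
    (hne : ∀ t ∈ QI, t ≠ π / 4 → sin t ^ 2 ≠ c) :
    ∫ t in QI, F t = 0 := by
  have hcm : (c : ℂ) ∈ Metric.ball (1:ℂ) 1 := by
    rw [mem_ball_iff_norm, ← Complex.ofReal_one, ← Complex.ofReal_sub, Complex.norm_real, Real.norm_eq_abs,
      abs_lt]
    constructor <;> linarith
  refine contour (dslope (fun v => Complex.log v ^ m) c) ?_ (4 * (2048 + ‖Complex.log c ^ m‖)) ?_ φ F hF ?_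
  · rw [Complex.differentiableOn_dslope (Metric.isOpen_ball.mem_nhds hcm)]
    exact log_pow_diff m
  · intro v hv hv4
    have hd : 1/4 ≤ ‖v - c‖ := by
      have := norm_sub_norm_le (c:ℂ) v
      rw [norm_sub_rev, Complex.norm_real, Real.norm_of_nonneg (by linarith)] at this
      linarith
    have hne : v ≠ c := by rintro rfl; simp at hd; linarith
    rw [dslope_of_ne _ hne, slope_def_field, norm_div]
    rw [div_le_iff₀ (by linarith)]
    have h1 := log_pow_norm (v := v) m hm
    have h2 := norm_sub_le (Complex.log v ^ m) (Complex.log c ^ m)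
    have h3 := norm_nonneg (Complex.log c ^ m)
    set a := |log ‖v‖| ^ 4
    have ha : 0 ≤ a := by positivity
    calc _ ≤ (2048 + ‖Complex.log c ^ m‖) * (1 + a) := by nlinarith
      _ = 4 * (2048 + ‖Complex.log c ^ m‖) * (1 + a) * (1/4) := by ring
      _ ≤ _ := by gcongr
  · intro t ht hpi
    have h := hne t ht hpi
    have hs := QI_sin_pos ht
    have hcs := QI_cos_pos ht
    rw [he t ht h]
    have n1 : wc t ≠ c := by
      intro h
      have := congrArg Complex.im h
      rw [wc_im, Complex.ofReal_im] at this
      have : 0 < sin t * cos t := by positivity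
      linarith
    have n2 : ((sin t ^ 2 : ℝ) : ℂ) ≠ c := by exact_mod_cast h
    rw [dslope_of_ne _ n1, dslope_of_ne _ n2, slope_def_field, slope_def_field, wc_log ht,
      ← Complex.ofReal_log (x := sin t ^ 2) (by positivity), ← Complex.ofReal_log (x := c) (by linarith), Real.log_pow]
    push_cast [ls]
    rfl

lemma contour1 (m : ℕ) (hm : m ≤ 4) (hm0 : m ≠ 0) (φ : ℂ →L[ℝ] ℝ) (F : ℝ → ℝ) (hF : IntegrableOn F QI)
    (he : ∀ t ∈ QI, F t = φ
      (((tan t : ℂ) - Complex.I) * ((ls t : ℂ) + ((t - π / 2 : ℝ) : ℂ) * Complex.I) ^ m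
       - ((2 ^ (m + 1) * ls t ^ m * tan t : ℝ) : ℂ))) :
    ∫ t in QI, F t = 0 := by
  have := contour_dslope m hm 1 (by norm_num) le_rfl φ (fun t => - F t) hF.neg ?_ ?_
  · rw [integral_neg] at this; linarith
  · intro t ht _
    have hs := QI_sin_pos ht
    have hc := QI_cos_pos ht
    show - F t = _
    rw [he t ht, ← map_neg]
    congr 1
    have hc' : Complex.cos t ≠ 0 := by rw [← Complex.ofReal_cos]; exact_mod_cast hc.ne'
    have hsc := Complex.sin_sq_add_cos_sq t
    have hw : wc t - (1:ℝ) ≠ 0 := by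
      intro h
      have := congrArg Complex.im h
      simp only [Complex.sub_im, wc_im, Complex.ofReal_im, Complex.zero_im] at this
      have : 0 < sin t * cos t := by positivity
      linarith
    have e1 : wd t = -((tan t : ℂ) - Complex.I) * (wc t - (1:ℝ)) := by
      rw [wc, wd, tan_eq_sin_div_cos]
      push_cast
      rw [← hsc]
      field_simp
      linear_combination (Complex.sin t * (Complex.cos t)^2) * Complex.I_sq
    have e2 : sin t ^ 2 - 1 = -cos t ^ 2 := by linarith [sin_sq_add_cos_sq t]
    rw [e1, e2, tan_eq_sin_div_cos]
    simp only [log_one]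
    push_cast
    rw [zero_pow hm0]
    push_cast at hw
    field_simp
    ring
  · intro t ht _
    have := QI_cos_pos ht
    nlinarith [sin_sq_add_cos_sq t, pow_pos this 2]

lemma sin_sq_half {t : ℝ} (ht : t ∈ QI) (h : t ≠ π / 4) : sin t ^ 2 ≠ 1 / 2 := by
  intro e
  have hc : cos (2 * t) = cos (π / 2) := by
    rw [cos_two_mul, cos_pi_div_two]; linarith [sin_sq_add_cos_sq t]
  have := Real.injOn_cos (⟨by linarith [ht.1], by linarith [ht.2]⟩ : 2 * t ∈ Icc 0 π)
    (⟨by positivity, by linarith [pi_pos]⟩ : π / 2 ∈ Icc 0 π) hc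
  exact h (by linarith)

lemma contour2 (m : ℕ) (hm : m ≤ 4) (φ : ℂ →L[ℝ] ℝ) (F : ℝ → ℝ) (hF : IntegrableOn F QI)
    (he : ∀ t ∈ QI, t ≠ π / 4 → F t = φ
      (- Complex.I * (((ls t : ℂ) + ((t - π / 2 : ℝ) : ℂ) * Complex.I) ^ m - (-log 2 : ℝ) ^ m)
       - ((((2 * ls t) ^ m - (-log 2) ^ m) / (1 - 2 * sin t ^ 2) * (2 * sin t * cos t) : ℝ) : ℂ))) :
    ∫ t in QI, F t = 0 := by
  have := contour_dslope m hm (1/2) le_rfl (by norm_num) φ (fun t => -2 * F t) (hF.const_mul _) ?_ ?_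
  · rw [integral_const_mul] at this; linarith
  · intro t ht hne
    have hs := QI_sin_pos ht
    have hc := QI_cos_pos ht
    have hp : t ≠ π / 4 := by
      rintro rfl
      apply hne
      rw [sin_pi_div_four, div_pow, Real.sq_sqrt (by norm_num)]; norm_num
    show -2 * F t = _
    rw [he t ht hp, ← smul_eq_mul, ← map_smul]
    congr 1
    have hsc := Complex.sin_sq_add_cos_sq t
    have hw : wc t - (1/2:ℝ) ≠ 0 := by
      intro h
      have := congrArg Complex.im h
      simp only [Complex.sub_im, wc_im, Complex.ofReal_im, Complex.zero_im] at this
      have : 0 < sin t * cos t := by positivity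
      linarith
    have e1 : wd t = (2 * Complex.I) * (wc t - (1/2:ℝ)) := by
      rw [wc, wd]
      push_cast
      linear_combination ((2:ℂ) * Complex.sin t * Complex.cos t) * Complex.I_sq - Complex.I * hsc
    have e2 : 1 - 2 * sin t ^ 2 = -2 * (sin t ^ 2 - 1/2) := by ring
    have e3 : log (1/2) = - log 2 := by rw [one_div, Real.log_inv]
    have hne' : sin t ^ 2 - 1 / 2 ≠ 0 := sub_ne_zero.2 hne
    have e4 : ((2 * ls t) ^ m - (-log 2) ^ m) / (1 - 2 * sin t ^ 2) * (2 * sin t * cos t)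
      = -(1/2) * (((2 * ls t) ^ m - (-log 2) ^ m) / (sin t ^ 2 - 1/2) * (2 * sin t * cos t)) := by
      rw [e2]; field_simp
    have e5 : ∀ z : ℂ, z / (wc t - (1/2:ℝ)) * (2 * Complex.I * (wc t - (1/2:ℝ))) = z * (2 * Complex.I) := by
      intro z; field_simp
    rw [e1, e3, e4, e5, Complex.real_smul]
    push_cast
    ring
  · intro t ht h
    exact sin_sq_half ht h

/-- `f` is integrable on `s` with integral `a`. -/
def HI (s : Set ℝ) (f : ℝ → ℝ) (a : ℝ) : Prop := IntegrableOn f s ∧ ∫ t in s, f t = a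

lemma HI.add {s : Set ℝ} {f g : ℝ → ℝ} {a b : ℝ} (hf : HI s f a) (hg : HI s g b) :
    HI s (fun t => f t + g t) (a + b) :=
  ⟨hf.1.add hg.1, by rw [integral_add hf.1 hg.1, hf.2, hg.2]⟩

lemma HI.sub {s : Set ℝ} {f g : ℝ → ℝ} {a b : ℝ} (hf : HI s f a) (hg : HI s g b) :
    HI s (fun t => f t - g t) (a - b) :=
  ⟨hf.1.sub hg.1, by rw [integral_sub hf.1 hg.1, hf.2, hg.2]⟩

lemma HI.smul {s : Set ℝ} {f : ℝ → ℝ} {a : ℝ} (c : ℝ) (hf : HI s f a) :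
    HI s (fun t => c * f t) (c * a) :=
  ⟨hf.1.const_mul c, by rw [integral_const_mul, hf.2]⟩

lemma HI.congr {s : Set ℝ} (hs : MeasurableSet s) {f g : ℝ → ℝ} {a b : ℝ} (hf : HI s f a)
    (h : ∀ t ∈ s, g t = f t) (hab : b = a) : HI s g b := by
  refine ⟨hf.1.congr_fun (fun t ht => (h t ht).symm) hs, ?_⟩
  rw [setIntegral_congr_fun hs h, hf.2, hab]

lemma HI.cg {f g : ℝ → ℝ} {a b : ℝ} (hf : HI QI f a)
    (h : ∀ t ∈ QI, g t = f t) (hab : b = a) : HI QI g b := hf.congr measurableSet_Ioo h hab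

lemma HI.uniq {s : Set ℝ} {f : ℝ → ℝ} {a b : ℝ} (hf : HI s f a) (hg : HI s f b) : a = b :=
  hf.2.symm.trans hg.2

/-- The basic integrals. -/
noncomputable def AA (i k : ℕ) : ℝ := ∫ t in QI, t ^ i * ls t ^ k

lemma hi_AA (i k : ℕ) (hk : k ≤ 4) : HI QI (fun t => t ^ i * ls t ^ k) (AA i k) := ⟨int_pl i k hk, rfl⟩

lemma AA_zero : AA 0 0 = π / 2 := by
  have : 0 ≤ π / 2 := by positivity
  simp [AA, this]

/-- Moments of the tangent -/
lemma tan_moment (m : ℕ) (hm : m = 2 ∨ m = 4) :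
    HI QI (fun t => tan t * ls t ^ m) (m.factorial * zetaVal (m + 1) / 2 ^ (m + 1)) := by
  have hi : IntegrableOn (fun t => tan t * ls t ^ m) QI := by
    have h := intQ_mul (f := fun t => ls t * tan t) 1 (m - 1) (by omega) (ls_cont.mul tan_cont)
      (fun t ht => ls_tan_bound ht)
    refine h.congr_fun (fun t _ => ?_) measurableSet_Ioo
    rcases hm with rfl | rfl <;> ring
  refine ⟨hi, ?_⟩
  have hev : Even m := by rcases hm with rfl | rfl <;> decide
  have h := hasSum_int (s := QI) measurableSet_Ioo
    (F := fun j t => sin t ^ (2 * j + 1) * cos t * ls t ^ m)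
    (f := fun t => tan t * ls t ^ m)
    (fun j => by have := ls_cont; fun_prop)
    (fun j t ht => by
      have := QI_cos_pos ht; have := QI_sin_pos ht; have := hev.pow_nonneg (ls t); positivity)
    (fun t ht => by
      have hc := QI_cos_pos ht
      have h1 : sin t ^ 2 < 1 := by nlinarith [sin_sq_add_cos_sq t]
      have h := (hasSum_geometric_of_lt_one (by positivity) h1).mul_right (sin t * cos t * ls t ^ m)
      refine hasSum_cg h (fun j => ?_) ?_
      · rw [pow_succ, pow_mul]; ring
      · rw [tan_eq_sin_div_cos, show 1 - sin t ^ 2 = cos t ^ 2 by linarith [sin_sq_add_cos_sq t]]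
        field_simp) hi
  simp_rw [sin_moment _ m (show m ≤ 4 by omega)] at h
  rw [← h.tsum_eq, zetaVal, ← tsum_mul_left, ← tsum_div_const]
  congr 1; ext j
  rw [hev.neg_one_pow, show ((2 * j + 1 : ℕ) : ℝ) + 1 = 2 * (j + 1) by push_cast; ring, mul_pow]
  field_simp

lemma flipQ (f : ℝ → ℝ) : ∫ t in QI, f (π / 2 - t) = ∫ t in QI, f t := by
  have h := intervalIntegral.integral_comp_sub_left (a := 0) (b := π/2) f (π/2)
  rw [sub_self, sub_zero, intervalIntegral.integral_of_le (by positivity),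
    intervalIntegral.integral_of_le (by positivity), integral_Ioc_eq_integral_Ioo,
    integral_Ioc_eq_integral_Ioo] at h
  exact h

lemma tl_tendsto (m : ℕ) (hm : m ≠ 0) : Tendsto (fun t => t ^ m * ls t) (𝓝[>] 0) (𝓝 0) := by
  have h := ((sin_pow_ls_tendsto m 1 (by omega)).abs).const_mul (2 ^ m)
  simp only [abs_zero, mul_zero] at h
  refine squeeze_zero_norm' ?_ h
  filter_upwards [tendsto_Ioo_left] with t ht
  have h1 := Real.mul_le_sin ht.1.le ht.2.le
  have hs := QI_sin_pos ht
  have h2 : t ≤ 2 * sin t := by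
    have h3 : t = π / 2 * (2 / π * t) := by field_simp
    rw [h3]
    have : π / 2 ≤ 2 := by linarith [pi_lt_four]
    have h4 : 0 ≤ 2 / π * t := by have := ht.1; positivity
    calc _ ≤ 2 * (2 / π * t) := by gcongr
      _ ≤ 2 * sin t := by linarith
      _ = _ := by rw [← h3]
  rw [norm_mul, norm_pow, Real.norm_of_nonneg ht.1.le, pow_one, abs_mul, abs_of_pos (pow_pos hs m),
    ← mul_assoc, ← mul_pow, Real.norm_eq_abs]
  have := ht.1
  gcongr

lemma tan_psi (m : ℕ) (hm : m = 2 ∨ m = 4) :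
    HI QI (fun t => tan t * (t - π/2) ^ m) (-(m * AA (m - 1) 1)) := by
  have hi : IntegrableOn (fun t => tan t * (t - π/2) ^ m) QI := by
    have h := intQ_mul (f := fun t => ((t - π/2) * tan t) * (t - π/2) ^ (m - 1)) (1 * 2 ^ (m - 1)) 0
      (by omega) ((psi_cont.mul tan_cont).mul (psi_cont.pow _))
      (fun t ht => by
        rw [abs_mul, abs_pow]
        have := psi_tan ht; have := psi_abs ht
        gcongr)
    refine h.congr_fun (fun t _ => ?_) measurableSet_Ioo
    rcases hm with rfl | rfl <;> ring
  refine ⟨hi, ?_⟩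
  have hi2 : IntegrableOn (fun t => t ^ m * (cos t / sin t)) QI := by
    refine (intQ_mul (f := fun t => t ^ m * (cos t / sin t)) (2 ^ (m - 1)) 0 (by omega) ?_ ?_).congr_fun
      (fun t _ => by simp) measurableSet_Ioo
    · refine ContinuousOn.mul (by fun_prop) (ContinuousOn.div (by fun_prop) (by fun_prop)
        fun t ht => (QI_sin_pos ht).ne')
    · intro t ht
      have h := psi_tan (QI_flip ht)
      rw [tan_pi_div_two_sub, tan_eq_sin_div_cos, inv_div, sub_sub_cancel_left, neg_mul, abs_neg] at h
      have h2 := QI_abs ht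
      calc |t ^ m * (cos t / sin t)| = |t| ^ (m - 1) * |t * (cos t / sin t)| := by
            rw [← abs_pow, ← abs_mul]; congr 1
            rcases hm with rfl | rfl <;> ring
        _ ≤ 2 ^ (m - 1) * 1 := by gcongr
        _ = _ := mul_one _
  have e1 : ∫ t in QI, tan t * (t - π/2) ^ m = ∫ t in QI, t ^ m * (cos t / sin t) := by
    rw [← flipQ]
    refine setIntegral_congr_fun measurableSet_Ioo fun t _ => ?_
    show tan (π / 2 - t) * (π / 2 - t - π / 2) ^ m = _
    rw [tan_pi_div_two_sub, tan_eq_sin_div_cos, inv_div, sub_sub_cancel_left]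
    rcases hm with rfl | rfl <;> ring
  rw [e1]
  have hA := (hi_AA (m - 1) 1 (by norm_num)).1
  have h := ftcE (F := fun t => t ^ m * ls t)
    (f := fun t => m * (t ^ (m - 1) * ls t ^ 1) + t ^ m * (cos t / sin t)) (a := 0) (b := π/2) (A := 0) (B := 0)
    (by positivity)
    (fun t ht => by
      have := (hasDerivAt_pow m t).mul (ls_hasDeriv ht)
      convert! this using 1; ring)
    (by exact (hA.const_mul _).add hi2) (tl_tendsto m (by omega)) (by
      have h1 : Tendsto (fun t : ℝ => t ^ m) (𝓝[<] (π/2)) (𝓝 ((π/2) ^ m)) :=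
        ((continuous_pow m).tendsto _).mono_left nhdsWithin_le_nhds
      simpa using h1.mul ls_tendsto_half)
  rw [integral_add (hA.const_mul _) hi2, integral_const_mul] at h
  change (m:ℝ) * AA (m - 1) 1 + _ = _ at h
  linarith

lemma hi_psi (j k : ℕ) (hk : k ≤ 4) : HI QI (fun t => (t - π/2) ^ j * ls t ^ k)
    (∫ t in QI, (t - π/2) ^ j * ls t ^ k) := by
  refine ⟨?_, rfl⟩
  refine intQ_mul (2 ^ j) k hk (psi_cont.pow j) fun t ht => ?_
  rw [abs_pow]; have := psi_abs ht; gcongr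

lemma rel_i4 : ∃ X, HI QI (fun t => 4 * ls t ^ 3 * (t - π/2) - 4 * ls t * (t - π/2) ^ 3) X ∧
    -31 * (24 * zetaVal 5 / 32) - 6 * (∫ t in QI, tan t * (t - π/2) ^ 2 * ls t ^ 2) - 4 * AA 3 1 + X = 0 := by
  have h1 := ((hi_psi 1 3 (by norm_num)).smul 4).sub ((hi_psi 3 1 (by norm_num)).smul 4)
  have h2 := h1.cg (g := fun t => 4 * ls t ^ 3 * (t - π/2) - 4 * ls t * (t - π/2) ^ 3)
    (fun t _ => by ring) rfl
  refine ⟨_, h2, ?_⟩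
  have hT := tan_moment 4 (by norm_num)
  have hP := tan_psi 4 (by norm_num)
  have hB : HI QI (fun t => tan t * (t - π/2) ^ 2 * ls t ^ 2) _ := ⟨int_B, rfl⟩
  have h := (((hT.smul (-31)).sub (hB.smul 6)).add hP).add h2
  have h0 := contour1 4 le_rfl (by norm_num) Complex.reCLM _ h.1 (fun t ht => by
    generalize t - π / 2 = p
    rw [Complex.reCLM_apply]
    generalize tan t = T
    simp [pow_succ]
    ring)
  rw [h.2] at h0
  norm_num [Nat.factorial] at h0 ⊢
  linarith

lemma rel_i2 : -7 * (2 * zetaVal 3 / 8) + 2 * AA 1 1 + 2 * (AA 1 1 - π / 2 * AA 0 1) = 0 := by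
  have h1 := ((hi_AA 1 1 (by norm_num)).sub ((hi_AA 0 1 (by norm_num)).smul (π/2)))
  have hT := tan_moment 2 (by norm_num)
  have hP := tan_psi 2 (by norm_num)
  have h := ((hT.smul (-7)).sub hP).add (h1.smul 2)
  have h0 := contour1 2 (by norm_num) (by norm_num) Complex.reCLM _ h.1 (fun t ht => by
    have e : t = (t - π/2) + π/2 := by ring
    generalize hp : t - π / 2 = p at *
    rw [Complex.reCLM_apply]
    generalize tan t = T
    simp [pow_succ]
    simp only [e]
    ring)
  rw [h.2] at h0
  norm_num [Nat.factorial] at h0 ⊢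
  linarith

lemma rel_iii1 : AA 0 1 + π / 2 * log 2 = 0 := by
  have h := (((hi_AA 0 1 (by norm_num)).add ((hi_AA 0 0 (by norm_num)).smul (log 2)))).smul (-1)
  have h0 := contour2 1 (by norm_num) Complex.imCLM _ h.1 (fun t ht _ => by
    generalize t - π / 2 = p
    rw [Complex.imCLM_apply, Complex.sub_im, Complex.ofReal_im]
    generalize log 2 = L
    simp
    try ring)
  rw [h.2, AA_zero] at h0
  linarith

lemma rel_iii3 : AA 0 3 - 3 * (AA 2 1 - π * AA 1 1 + π ^ 2 / 4 * AA 0 1) + π / 2 * log 2 ^ 3 = 0 := by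
  have h2 := ((hi_AA 2 1 (by norm_num)).sub ((hi_AA 1 1 (by norm_num)).smul π)).add
    ((hi_AA 0 1 (by norm_num)).smul (π ^ 2 / 4))
  have h := (((hi_AA 0 3 (by norm_num)).sub (h2.smul 3)).add
    ((hi_AA 0 0 (by norm_num)).smul (log 2 ^ 3))).smul (-1)
  have h0 := contour2 3 (by norm_num) Complex.imCLM _ h.1 (fun t ht _ => by
    have e : t = (t - π/2) + π/2 := by ring
    generalize hp : t - π / 2 = p at *
    rw [Complex.imCLM_apply, Complex.sub_im, Complex.ofReal_im]
    generalize log 2 = L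
    simp [pow_succ]
    simp only [e]
    ring)
  rw [h.2, AA_zero] at h0
  linarith

/-- the quantity `∫ q` transported to the angle -/
lemma rel_ii {P X : ℝ}
    (hP : HI QI (fun t => ((2 * ls t) ^ 4 - (log 2) ^ 4) / (1 - 2 * sin t ^ 2) * (2 * sin t * cos t)) P)
    (hX : HI QI (fun t => 4 * ls t ^ 3 * (t - π/2) - 4 * ls t * (t - π/2) ^ 3) X) : X = P := by
  have h := hX.sub hP
  have h0 := contour2 4 (by norm_num) Complex.reCLM _ h.1 (fun t ht _ => by
    generalize t - π / 2 = p
    rw [Complex.reCLM_apply, Complex.sub_re, Complex.ofReal_re,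
      show (-log 2) ^ 4 = log 2 ^ 4 by ring]
    congr 1
    generalize log 2 = L
    simp [pow_succ]
    ring)
  rw [h.2] at h0
  linarith

lemma X_expand {X : ℝ}
    (hX : HI QI (fun t => 4 * ls t ^ 3 * (t - π/2) - 4 * ls t * (t - π/2) ^ 3) X) :
    X = 4 * (AA 1 3 - π / 2 * AA 0 3)
      - 4 * (AA 3 1 - 3 * π / 2 * AA 2 1 + 3 * π ^ 2 / 4 * AA 1 1 - π ^ 3 / 8 * AA 0 1) := by
  have h1 := ((hi_AA 1 3 (by norm_num)).sub ((hi_AA 0 3 (by norm_num)).smul (π/2))).smul 4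
  have h2 := ((((hi_AA 3 1 (by norm_num)).sub ((hi_AA 2 1 (by norm_num)).smul (3 * π/2))).add
    ((hi_AA 1 1 (by norm_num)).smul (3 * π ^ 2 / 4))).sub
    ((hi_AA 0 1 (by norm_num)).smul (π ^ 3 / 8))).smul 4
  exact hX.uniq ((h1.sub h2).cg (fun t _ => by ring) rfl)

lemma HI_image {s s' : Set ℝ} (hs : MeasurableSet s) {p p' : ℝ → ℝ} (f : ℝ → ℝ) {a : ℝ}
    (hp : ∀ x ∈ s, HasDerivAt p (p' x) x) (hinj : InjOn p s) (him : p '' s = s') :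
    HI s' f a ↔ HI s (fun t => |p' t| * f (p t)) a := by
  have h1 := integrableOn_image_iff_integrableOn_abs_deriv_smul hs
    (fun x hx => (hp x hx).hasDerivWithinAt) hinj f
  have h2 := integral_image_eq_integral_abs_deriv_smul hs
    (fun x hx => (hp x hx).hasDerivWithinAt) hinj f
  simp only [smul_eq_mul, him] at h1 h2
  unfold HI
  rw [h1, h2]

lemma HI_glue {a b c : ℝ} (hab : a ≤ b) (hbc : b ≤ c) {f : ℝ → ℝ} {x y : ℝ}
    (h1 : HI (Ioo a b) f x) (h2 : HI (Ioo b c) f y) : HI (Ioo a c) f (x + y) := by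
  unfold HI at *
  rw [← integrableOn_Ioc_iff_integrableOn_Ioo, ← integral_Ioc_eq_integral_Ioo] at *
  rw [← Ioc_union_Ioc_eq_Ioc hab hbc]
  refine ⟨h1.1.union h2.1, ?_⟩
  rw [setIntegral_union (Ioc_disjoint_Ioc_of_le le_rfl) measurableSet_Ioc h1.1 h2.1, h1.2, h2.2]

lemma HI_unglue {a b c : ℝ} (hab : a ≤ b) (hbc : b ≤ c) {f : ℝ → ℝ} {x y : ℝ}
    (h1 : HI (Ioo a b) f x) (h2 : HI (Ioo a c) f y) : HI (Ioo b c) f (y - x) := by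
  have h3 : HI (Ioo b c) f (∫ t in Ioo b c, f t) :=
    ⟨h2.1.mono_set (Ioo_subset_Ioo_left hab), rfl⟩
  have := (HI_glue hab hbc h1 h3).uniq h2
  rw [← this, add_sub_cancel_left]; exact h3

lemma tan_moment' (m : ℕ) (hm : 1 ≤ m) (hm4 : m ≤ 4) :
    HI QI (fun t => tan t * ls t ^ m) ((-1) ^ m * m.factorial * zetaVal (m + 1) / 2 ^ (m + 1)) := by
  have hi : IntegrableOn (fun t => tan t * ls t ^ m) QI := by
    have h := intQ_mul (f := fun t => ls t * tan t) 1 (m - 1) (by omega) (ls_cont.mul tan_cont)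
      (fun t ht => ls_tan_bound ht)
    refine h.congr_fun (fun t _ => ?_) measurableSet_Ioo
    obtain ⟨n, rfl⟩ : ∃ n, m = n + 1 := ⟨m - 1, by omega⟩
    simp only [Nat.add_sub_cancel]
    ring
  refine ⟨hi, ?_⟩
  have h := hasSum_int (s := QI) measurableSet_Ioo
    (F := fun j t => (-1) ^ m * (sin t ^ (2 * j + 1) * cos t * ls t ^ m))
    (f := fun t => (-1) ^ m * (tan t * ls t ^ m))
    (fun j => by have := ls_cont; fun_prop)
    (fun j t ht => by
      have := QI_cos_pos ht; have := QI_sin_pos ht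
      have h3 : 0 ≤ (- ls t) ^ m := pow_nonneg (by linarith [ls_nonpos ht]) m
      have h4 : (-1) ^ m * (sin t ^ (2 * j + 1) * cos t * ls t ^ m) =
        sin t ^ (2 * j + 1) * cos t * (- ls t) ^ m := by rw [neg_pow (ls t)]; ring
      rw [h4]; positivity)
    (fun t ht => by
      have hc := QI_cos_pos ht
      have h1 : sin t ^ 2 < 1 := by nlinarith [sin_sq_add_cos_sq t]
      have h := (hasSum_geometric_of_lt_one (by positivity) h1).mul_right
        ((-1) ^ m * (sin t * cos t * ls t ^ m))
      refine hasSum_cg h (fun j => ?_) ?_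
      · rw [pow_succ, pow_mul]; ring
      · rw [tan_eq_sin_div_cos, show 1 - sin t ^ 2 = cos t ^ 2 by linarith [sin_sq_add_cos_sq t]]
        field_simp) (hi.const_mul _)
  simp_rw [integral_const_mul, sin_moment _ m hm4] at h
  have hsq : ((-1:ℝ) ^ m) * (-1) ^ m = 1 := by rw [← mul_pow]; norm_num
  have h2 := h.mul_left ((-1) ^ m)
  rw [← mul_assoc, hsq, one_mul] at h2
  rw [← h2.tsum_eq, zetaVal, ← tsum_mul_left, ← tsum_div_const]
  congr 1; ext j
  rw [show ((2 * j + 1 : ℕ) : ℝ) + 1 = 2 * (j + 1) by push_cast; ring, mul_pow, ← mul_assoc, hsq]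
  field_simp

lemma sin_sq_image : (fun t => sin t ^ 2) '' QI = Ioo 0 1 := by
  ext x; constructor
  · rintro ⟨t, ht, rfl⟩
    have hs := QI_sin_pos ht
    have hc := QI_cos_pos ht
    exact ⟨by positivity, by nlinarith [sin_sq_add_cos_sq t]⟩
  · rintro ⟨h0, h1⟩
    have hq0 : 0 < √x := Real.sqrt_pos.2 h0
    have hq1 : √x < 1 := by rw [Real.sqrt_lt' one_pos]; simpa using h1
    refine ⟨arcsin √x, ⟨Real.arcsin_pos.2 hq0, Real.arcsin_lt_pi_div_two.2 hq1⟩, ?_⟩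
    show sin (arcsin √x) ^ 2 = x
    rw [Real.sin_arcsin (by linarith) hq1.le, Real.sq_sqrt h0.le]

lemma HI_sin_sq (f : ℝ → ℝ) (a : ℝ) :
    HI (Ioo 0 1) f a ↔ HI QI (fun t => (2 * sin t * cos t) * f (sin t ^ 2)) a := by
  rw [HI_image (s := QI) measurableSet_Ioo f (fun t _ => sin_sq_deriv t) ?_ sin_sq_image]
  · constructor <;>
    · intro h
      refine h.cg (fun t ht => ?_) rfl
      have hs := QI_sin_pos ht
      have hc := QI_cos_pos ht
      rw [abs_of_pos (by positivity)]
  · intro x hx y hy h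
    have h1 : sin x = sin y := by
      have := QI_sin_pos hx
      have := QI_sin_pos hy
      exact (pow_left_inj₀ (by linarith) (by linarith) two_ne_zero).1 h
    exact Real.injOn_sin ⟨by linarith [hx.1, pi_pos], hx.2.le⟩ ⟨by linarith [hy.1, pi_pos], hy.2.le⟩ h1

lemma log_int (m : ℕ) (hm : 1 ≤ m) (hm4 : m ≤ 4) :
    HI (Ioo 0 1) (fun v => log v ^ m / (1 - v)) ((-1) ^ m * m.factorial * zetaVal (m + 1)) := by
  rw [HI_sin_sq]
  refine ((tan_moment' m hm hm4).smul (2 ^ (m + 1))).cg (fun t ht => ?_) ?_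
  · have hc := QI_cos_pos ht
    rw [Real.log_pow, show 1 - sin t ^ 2 = cos t ^ 2 by linarith [sin_sq_add_cos_sq t],
      tan_eq_sin_div_cos, ls]
    push_cast
    rw [mul_pow]
    field_simp
    ring
  · field_simp

lemma log_int4 (s : ℝ) : HI (Ioo 0 1) (fun v => ((log v + s) ^ 4 - s ^ 4) / (1 - v))
    (24 * zetaVal 5 - 24 * s * zetaVal 4 + 12 * s ^ 2 * zetaVal 3 - 4 * s ^ 3 * zetaVal 2) := by
  have h := (((log_int 4 (by norm_num) (by norm_num)).add
    ((log_int 3 (by norm_num) (by norm_num)).smul (4 * s))).add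
    ((log_int 2 (by norm_num) (by norm_num)).smul (6 * s ^ 2))).add
    ((log_int 1 (by norm_num) (by norm_num)).smul (4 * s ^ 3))
  refine h.congr measurableSet_Ioo (fun t _ => by ring) ?_
  norm_num [Nat.factorial]; ring

lemma half_image : (fun v : ℝ => v / 2) '' Ioo 0 1 = Ioo 0 (1/2) := by
  ext x; constructor
  · rintro ⟨t, ht, rfl⟩
    exact ⟨by simpa using ht.1, by simp only; linarith [ht.2]⟩
  · rintro ⟨h0, h1⟩
    exact ⟨2 * x, ⟨by linarith, by linarith⟩, by simp⟩

lemma HI_half (f : ℝ → ℝ) (a : ℝ) :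
    HI (Ioo 0 (1/2)) f a ↔ HI (Ioo 0 1) (fun v => 1/2 * f (v / 2)) a := by
  rw [HI_image (s := Ioo 0 1) measurableSet_Ioo f (p' := fun _ => 1/2)
    (fun t _ => (hasDerivAt_id t).div_const 2) ?_ half_image]
  · norm_num
  · intro x _ y _ h
    simp only [id] at h; linarith

lemma inv_image : (fun v : ℝ => (2 * v)⁻¹) '' Ioo (1/2) 1 = Ioo (1/2) 1 := by
  have key : ∀ x ∈ Ioo (1/2:ℝ) 1, (2 * x)⁻¹ ∈ Ioo (1/2:ℝ) 1 := by
    intro x hx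
    have h0 : 0 < 2 * x := by linarith [hx.1]
    constructor
    · rw [lt_inv_comm₀ (by norm_num) h0]; linarith [hx.2]
    · rw [inv_lt_one₀ h0]; linarith [hx.1]
  ext x; constructor
  · rintro ⟨t, ht, rfl⟩
    exact key t ht
  · intro hx
    have : x ≠ 0 := by have := hx.1; intro h; linarith
    exact ⟨(2 * x)⁻¹, key x hx, by simp only; field_simp⟩

lemma HI_inv (f : ℝ → ℝ) (a : ℝ) :
    HI (Ioo (1/2) 1) f a ↔ HI (Ioo (1/2) 1) (fun v => 1 / (2 * v ^ 2) * f ((2 * v)⁻¹)) a := by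
  rw [HI_image (s := Ioo (1/2) 1) measurableSet_Ioo f (p' := fun v => -(1 / (2 * v ^ 2)))
    (fun t ht => ?_) ?_ inv_image]
  · constructor <;>
    · intro h
      refine h.congr measurableSet_Ioo (fun t ht => ?_) rfl
      rw [abs_neg, abs_of_nonneg (by positivity)]
  · intro x hx y hy h
    have := inv_injective h
    linarith
  · have h0 : t ≠ 0 := by have := ht.1; intro h; linarith
    have := ((hasDerivAt_id t).const_mul (2:ℝ)).inv (by simpa using h0)
    convert! this using 1
    simp only [id]; field_simp

lemma hi_Li : HI (Ioo 0 1) (fun y => log y ^ 4 / (2 - y)) (24 * polyLog 5 (1/2)) := by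
  have hi : IntegrableOn (fun y => log y ^ 4 / (2 - y)) (Ioo 0 1) := by
    refine Integrable.mono' log_bound_integrable (ContinuousOn.aestronglyMeasurable ?_ measurableSet_Ioo) ?_
    · refine ContinuousOn.div ((continuousOn_log.mono ?_).pow 4) (by fun_prop) ?_
      · intro x hx; exact hx.1.ne'
      · intro x hx; have := hx.2; intro h; linarith
    · filter_upwards [self_mem_ae_restrict measurableSet_Ioo] with x hx
      have h2 : 1 ≤ 2 - x := by linarith [hx.2]
      rw [norm_div, norm_pow, Real.norm_eq_abs, Real.norm_of_nonneg (by linarith), div_le_iff₀ (by linarith)]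
      have : 0 ≤ |log x| ^ 4 := by positivity
      nlinarith
  refine ⟨hi, ?_⟩
  have h := hasSum_int (s := Ioo 0 1) measurableSet_Ioo
    (F := fun j y => (1/2) ^ (j + 1) * (y ^ j * log y ^ 4))
    (f := fun y => log y ^ 4 / (2 - y))
    (fun j => by
      have : ContinuousOn log (Ioo 0 1) := continuousOn_log.mono fun x hx => hx.1.ne'
      fun_prop)
    (fun j t ht => by have := ht.1; positivity)
    (fun t ht => by
      have h1 : t / 2 < 1 := by linarith [ht.2]
      have h0 : 0 ≤ t / 2 := by linarith [ht.1]
      have h := (hasSum_geometric_of_lt_one h0 h1).mul_right (1/2 * log t ^ 4)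
      refine hasSum_cg h (fun j => ?_) ?_
      · rw [div_pow, pow_succ, div_pow]; ring
      · have : 2 - t ≠ 0 := by have := ht.2; intro h; linarith
        have : 1 - t / 2 ≠ 0 := by have := ht.2; intro h; linarith
        field_simp) hi
  simp_rw [integral_const_mul, log_moment _ 4 le_rfl] at h
  rw [← h.tsum_eq, polyLog, ← tsum_mul_left]
  congr 1; ext j
  norm_num [Nat.factorial]
  ring

lemma hi_FTC {a b : ℝ} (hab : a < b) {F f : ℝ → ℝ} (hF : ∀ x ∈ Icc a b, HasDerivAt F (f x) x)
    (hf : ContinuousOn f (Icc a b)) : HI (Ioo a b) f (F b - F a) := by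
  have hi : IntegrableOn f (Ioo a b) := (hf.integrableOn_Icc).mono_set Ioo_subset_Icc_self
  refine ⟨hi, ftcE hab (fun x hx => hF x (Ioo_subset_Icc_self hx)) hi ?_ ?_⟩
  · exact (hF a (left_mem_Icc.2 hab.le)).continuousAt.tendsto.mono_left nhdsWithin_le_nhds
  · exact (hF b (right_mem_Icc.2 hab.le)).continuousAt.tendsto.mono_left nhdsWithin_le_nhds

lemma hi_L4 : HI (Ioo 0 1) (fun y : ℝ => 1 / (2 - y)) (log 2) := by
  have h := hi_FTC (a := 0) (b := 1) one_pos (F := fun y => - log (2 - y)) (f := fun y => 1 / (2 - y))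
    (fun x hx => by
      have h2 : 2 - x ≠ 0 := by have := hx.2; intro h; linarith
      have := (((hasDerivAt_id x).const_sub 2).log h2).neg
      convert! this using 1
      simp [neg_div])
    (ContinuousOn.div (by fun_prop) (by fun_prop) fun x hx => by
      have := hx.2; intro h; linarith)
  norm_num at h
  simpa using h

lemma hi_Nv : HI (Ioo (1/2) 1) (fun v => ((log v + log 2) ^ 4 - log 2 ^ 4) / v) (-(4/5) * log 2 ^ 5) := by
  have h := hi_FTC (a := 1/2) (b := 1) (by norm_num)
    (F := fun v => (log v + log 2) ^ 5 / 5 - log 2 ^ 4 * log v)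
    (f := fun v => ((log v + log 2) ^ 4 - log 2 ^ 4) / v)
    (fun x hx => by
      have h2 : x ≠ 0 := by have := hx.1; intro h; linarith
      have h3 := Real.hasDerivAt_log h2
      have := (((h3.add_const (log 2)).pow 5).div_const 5).sub (h3.const_mul (log 2 ^ 4))
      convert! this using 1
      push_cast; field_simp; try ring)
    (by
      have h2 : ∀ x ∈ Icc (1/2:ℝ) 1, x ≠ 0 := fun x hx => by have := hx.1; intro h; linarith
      have : ContinuousOn log (Icc (1/2:ℝ) 1) := continuousOn_log.mono h2
      exact ContinuousOn.div (by fun_prop) (by fun_prop) h2)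
  refine h.congr measurableSet_Ioo (fun _ _ => rfl) ?_
  rw [one_div, Real.log_inv, Real.log_one]; ring

lemma P_value : HI (Ioo 0 1) (fun x => (log x ^ 4 - log 2 ^ 4) / (1 - 2 * x))
    (24 * log 2 * zetaVal 4 + 4 * log 2 ^ 3 * zetaVal 2 + 12 * polyLog 5 (1/2) - log 2 ^ 5 / 10) := by
  have hl : HI (Ioo 0 (1/2)) (fun x => (log x ^ 4 - log 2 ^ 4) / (1 - 2 * x))
      ((1/2) * (24 * zetaVal 5 - 24 * (-log 2) * zetaVal 4 + 12 * (-log 2) ^ 2 * zetaVal 3 - 4 * (-log 2) ^ 3 * zetaVal 2)) := by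
    rw [HI_half]
    refine ((log_int4 (-log 2)).smul (1/2)).congr measurableSet_Ioo (fun v hv => ?_) rfl
    rw [Real.log_div hv.1.ne' (by norm_num)]
    ring_nf
  have h3 : HI (Ioo 0 (1/2)) (fun v => ((log v + log 2) ^ 4 - log 2 ^ 4) / (1 - v))
      (24 * polyLog 5 (1/2) - log 2 ^ 4 * log 2) := by
    rw [HI_half]
    refine (hi_Li.sub (hi_L4.smul (log 2 ^ 4))).congr measurableSet_Ioo (fun v hv => ?_) rfl
    rw [Real.log_div hv.1.ne' (by norm_num)]
    have h2 : 2 - v ≠ 0 := by have := hv.2; intro h; linarith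
    have h1 : 1 - v / 2 ≠ 0 := by have := hv.2; intro h; linarith
    field_simp
    ring
  have h4 := HI_unglue (by norm_num) (by norm_num) h3 (log_int4 (log 2))
  have hr : HI (Ioo (1/2) 1) (fun x => (log x ^ 4 - log 2 ^ 4) / (1 - 2 * x))
      (-(1/2) * (-(4/5) * log 2 ^ 5 + (24 * zetaVal 5 - 24 * log 2 * zetaVal 4 + 12 * log 2 ^ 2 * zetaVal 3
        - 4 * log 2 ^ 3 * zetaVal 2 - (24 * polyLog 5 (1/2) - log 2 ^ 4 * log 2)))) := by
    rw [HI_inv]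
    refine ((hi_Nv.add h4).smul (-(1/2))).congr measurableSet_Ioo (fun v hv => ?_) rfl
    have hv0 : v ≠ 0 := by have := hv.1; intro h; linarith
    have hv1 : 1 - v ≠ 0 := by have := hv.2; intro h; linarith
    have hv2 : v - 1 ≠ 0 := by have := hv.2; intro h; linarith
    rw [Real.log_inv, Real.log_mul (by norm_num) hv0]
    have e : 1 - 2 * (2 * v)⁻¹ = -(1 - v) / v := by field_simp; ring
    rw [e]
    field_simp
    ring
  refine (HI_glue (by norm_num) (by norm_num) hl hr).congr measurableSet_Ioo (fun _ _ => rfl) ?_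
  ring

lemma P_value_QI : HI QI (fun t => ((2 * ls t) ^ 4 - (log 2) ^ 4) / (1 - 2 * sin t ^ 2) * (2 * sin t * cos t))
    (24 * log 2 * zetaVal 4 + 4 * log 2 ^ 3 * zetaVal 2 + 12 * polyLog 5 (1/2) - log 2 ^ 5 / 10) := by
  refine ((HI_sin_sq _ _).1 P_value).cg (fun t ht => ?_) rfl
  rw [Real.log_pow, ls]; push_cast; ring

lemma zeta2 : zetaVal 2 = π ^ 2 / 6 := by
  have h := hasSum_zeta_two
  rw [← hasSum_nat_add_iff' 1] at h
  simp at h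
  rw [zetaVal, ← h.tsum_eq]
  congr 1; ext n; simp

lemma zeta4 : zetaVal 4 = π ^ 4 / 90 := by
  have h := hasSum_zeta_four
  rw [← hasSum_nat_add_iff' 1] at h
  simp at h
  rw [zetaVal, ← h.tsum_eq]
  congr 1; ext n; simp

theorem stmt_2 :
    ∑' k : ℕ, (4 : ℝ) ^ (k + 1) * (genHarmonic (k + 1) 1) ^ 2 /
      ((k + 1 : ℝ) ^ 3 * (Nat.choose (2 * (k + 1)) (k + 1) : ℝ))
    = -62 * zetaVal 5 - 21 / 2 * zetaVal 2 * zetaVal 3 + 48 * polyLog 5 (1 / 2)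
      + 81 * Real.log 2 * zetaVal 4 + 8 * Real.log 2 ^ 3 * zetaVal 2 - 2 / 5 * Real.log 2 ^ 5 := by
  rw [main_series]
  obtain ⟨X, hX, h4⟩ := rel_i4
  have hXP := rel_ii P_value_QI hX
  have hXe := X_expand hX
  have h2 := rel_i2
  have h1 := rel_iii1
  have h3 := rel_iii3
  have hA : (∫ t in QI, t ^ 3 * ls t) = AA 3 1 := by simp [AA]
  have hD : (∫ t in QI, t * ls t ^ 3) = AA 1 3 := by simp [AA]
  rw [hA, hD]
  have hC : AA 0 1 = -(π / 2 * log 2) := by linarith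
  have hC3 : AA 0 3 = 3 * (AA 2 1 - π * AA 1 1 + π ^ 2 / 4 * AA 0 1) - π / 2 * log 2 ^ 3 := by linarith
  have hA1 : AA 1 1 = 7 / 16 * zetaVal 3 + π / 4 * AA 0 1 := by linarith
  rw [hC] at hA1
  rw [hC3, hA1, hC] at hXe
  have hB : (∫ t in QI, tan t * (t - π/2) ^ 2 * ls t ^ 2) =
    (-31 * (24 * zetaVal 5 / 32) - 4 * AA 3 1 + X) / 6 := by linarith
  have hDD : AA 1 3 = X / 4 + AA 3 1 + (AA 1 3 - X / 4 - AA 3 1) := by ring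
  rw [hXe] at hXP
  rw [zeta2, zeta4] at *
  rw [hB, hXe]
  linear_combination 4 * hXP
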